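/- arXiv:1608.02568 — 13 statements merged into one kernel-verified Lean document; each statement's English description precedes it below -/
import Mathlib

section
/- Let ζ : (0,∞) → ℂ be smooth with ζ'(z) ≠ 0 and ζ''(z) ≠ 0 for all z > 0, and suppose ζ satisfies the ζ-form equation (zζ''(z))² = 4(ζ'(z))²(ζ(z) − zζ'(z)) − 4ζ'(z) on (0,∞). Then the function w := −1/ζ' satisfies the Painlevé III(D8) equation w'' = (w')²/w − w'/z + 2w²/z² − 2/z on (0,∞). -/
theorem painleveIII_D8_from_zeta_form
    (ζ : ℝ → ℂ) (hζ : ContDiffOn ℝ (⊤ : ℕ∞) ζ (Set.Ioi 0))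
    (hζ' : ∀ z ∈ Set.Ioi (0:ℝ), deriv ζ z ≠ 0)
    (hζ'' : ∀ z ∈ Set.Ioi (0:ℝ), deriv (deriv ζ) z ≠ 0)
    (hzeta : ∀ z ∈ Set.Ioi (0:ℝ),
      ((z : ℂ) * deriv (deriv ζ) z) ^ 2
        = 4 * (deriv ζ z) ^ 2 * (ζ z - (z : ℂ) * deriv ζ z) - 4 * deriv ζ z)
    (w : ℝ → ℂ) (hw : w = fun z => -1 / deriv ζ z) :
    ∀ z ∈ Set.Ioi (0:ℝ),
      deriv (deriv w) z
        = (deriv w z) ^ 2 / w z - deriv w z / (z : ℂ)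
          + 2 * (w z) ^ 2 / (z : ℂ) ^ 2 - 2 / (z : ℂ) := by
  intro z hz
  have hD : ∀ f : ℝ → ℂ, ContDiffOn ℝ (⊤ : ℕ∞) f (Set.Ioi 0) →
      ContDiffOn ℝ (⊤ : ℕ∞) (deriv f) (Set.Ioi 0) := by
    intro f hf
    exact hf.deriv_of_isOpen isOpen_Ioi (by simp)
  have hH : ∀ f : ℝ → ℂ, ContDiffOn ℝ (⊤ : ℕ∞) f (Set.Ioi 0) →
      ∀ x ∈ Set.Ioi (0:ℝ), HasDerivAt f (deriv f x) x := by
    intro f hf x hx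
    exact ((hf.differentiableOn (by simp)).differentiableAt (isOpen_Ioi.mem_nhds hx)).hasDerivAt
  have h0 := hH ζ hζ
  have h1 := hH _ (hD _ hζ)
  have h2 := hH _ (hD _ (hD _ hζ))
  have hw1 : ∀ x ∈ Set.Ioi (0:ℝ), deriv w x = deriv (deriv ζ) x / (deriv ζ x) ^ 2 := by
    intro x hx
    have := ((hasDerivAt_const x (-1 : ℂ)).div (h1 x hx) (hζ' x hx)).deriv
    rw [hw]
    refine Eq.trans this ?_
    ring
  have hw2 : deriv (deriv w) z = deriv (deriv (deriv ζ)) z / (deriv ζ z) ^ 2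
      - 2 * (deriv (deriv ζ) z) ^ 2 / (deriv ζ z) ^ 3 := by
    have he : deriv w =ᶠ[nhds z] (fun x => deriv (deriv ζ) x / (deriv ζ x) ^ 2) := by
      filter_upwards [isOpen_Ioi.mem_nhds hz] with x hx using hw1 x hx
    rw [he.deriv_eq]
    have hp := hζ' z hz
    have := ((h2 z hz).div ((h1 z hz).pow 2) (pow_ne_zero 2 hp)).deriv
    refine Eq.trans this ?_
    simp only [Pi.pow_apply]
    field_simp
    try push_cast
    try ring
  have hid : HasDerivAt (fun x : ℝ => (x : ℂ)) 1 z := Complex.ofRealCLM.hasDerivAt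
  have hL := (hid.mul (h2 z hz)).pow 2
  have hR := ((((h1 z hz).pow 2).const_mul 4).mul
    ((h0 z hz).sub (hid.mul (h1 z hz)))).sub ((h1 z hz).const_mul 4)
  have hE := hL.unique (hR.congr_of_eventuallyEq (by
    filter_upwards [isOpen_Ioi.mem_nhds hz] with x hx using hzeta x hx))
  simp only [Pi.pow_apply, Pi.mul_apply, Pi.sub_apply] at hE
  have hz0 : (z : ℂ) ≠ 0 := by exact_mod_cast (ne_of_gt hz)
  have hp := hζ' z hz
  have hq := hζ'' z hz
  have hz1 := hzeta z hz
  rw [hw2, hw1 z hz, hw]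
  clear hL hR
  beta_reduce
  generalize deriv (deriv (deriv ζ)) z = r at *
  generalize deriv (deriv ζ) z = q at *
  generalize deriv ζ z = p at *
  have key : p * (z^2 * r + z * q) = z^2*q^2 + 2*p - 2*p^3*z := by
    have : (2 * q) * (p * (z^2 * r + z * q)) = (2 * q) * (z^2*q^2 + 2*p - 2*p^3*z) := by
      push_cast at hE
      linear_combination p * hE - 2 * q * hz1
    exact mul_left_cancel₀ (mul_ne_zero two_ne_zero hq) this
  field_simp
  linear_combination key
end

section
/- Let w : (0,∞) → ℂ be smooth, nowhere vanishing, and satisfy the Painlevé III(D8) equation w'' = (w')²/w − w'/z + 2w²/z² − 2/z. Define p(z) := z·w'(z)/(2w(z)²) and ζ(z) := p(z)²w(z)² − w(z) − z/w(z). Then ζ'(z) = −1/w(z) for all z > 0, and ζ satisfies the ζ-form equation (zζ'')² = 4(ζ')²(ζ − zζ') − 4ζ' on (0,∞). -/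
theorem zeta_form_from_painleveIII_D8
    (w : ℝ → ℂ) (hw : ContDiffOn ℝ (⊤ : ℕ∞) w (Set.Ioi 0))
    (hw0 : ∀ z ∈ Set.Ioi (0:ℝ), w z ≠ 0)
    (hPIII : ∀ z ∈ Set.Ioi (0:ℝ),
      deriv (deriv w) z
        = (deriv w z) ^ 2 / w z - deriv w z / (z : ℂ)
          + 2 * (w z) ^ 2 / (z : ℂ) ^ 2 - 2 / (z : ℂ))
    (p ζ : ℝ → ℂ)
    (hp : p = fun z : ℝ => (z : ℂ) * deriv w z / (2 * (w z) ^ 2))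
    (hζ : ζ = fun z => (p z) ^ 2 * (w z) ^ 2 - w z - (z : ℂ) / w z) :
    ∀ z ∈ Set.Ioi (0:ℝ),
      deriv ζ z = -1 / w z ∧
      ((z : ℂ) * deriv (deriv ζ) z) ^ 2
        = 4 * (deriv ζ z) ^ 2 * (ζ z - (z : ℂ) * deriv ζ z) - 4 * deriv ζ z := by
  have hd1 : ∀ z ∈ Set.Ioi (0:ℝ), HasDerivAt w (deriv w z) z := by
    intro z hz
    exact ((hw.contDiffAt (isOpen_Ioi.mem_nhds hz)).differentiableAt (by simp)).hasDerivAt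
  have hw' : ContDiffOn ℝ 1 (deriv w) (Set.Ioi 0) :=
    hw.deriv_of_isOpen isOpen_Ioi (by norm_cast)
  have hd2 : ∀ z ∈ Set.Ioi (0:ℝ), HasDerivAt (deriv w) (deriv (deriv w) z) z := by
    intro z hz
    exact ((hw'.contDiffAt (isOpen_Ioi.mem_nhds hz)).differentiableAt (by simp)).hasDerivAt
  have hid : ∀ z : ℝ, HasDerivAt (fun x : ℝ => (x : ℂ)) 1 z := fun z =>
    (hasDerivAt_id z).ofReal_comp
  have key : ∀ z ∈ Set.Ioi (0:ℝ), deriv ζ z = -1 / w z := by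
    intro z hz
    have hwz := hw0 z hz
    have hzc : (z : ℂ) ≠ 0 := by
      have : z ≠ 0 := ne_of_gt hz
      exact_mod_cast this
    have h2 : (2 * (w z) ^ 2) ≠ 0 := by simp [hwz]
    have hP := ((hid z).mul (hd2 z hz)).div (((hd1 z hz).pow 2).const_mul 2) h2
    have hZ := (((hP.pow 2).mul ((hd1 z hz).pow 2)).sub (hd1 z hz)).sub
      ((hid z).div (hd1 z hz) hwz)
    rw [hζ, hp]
    refine hZ.deriv.trans ?_
    rw [hPIII z hz]
    simp only [Pi.mul_apply, Pi.pow_apply, Pi.div_apply, Nat.add_one_sub_one, Nat.reduceSub, pow_one, Nat.cast_ofNat]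
    field_simp
    ring
  intro z hz
  refine ⟨key z hz, ?_⟩
  have hwz := hw0 z hz
  have hdd : deriv (deriv ζ) z = deriv w z / (w z) ^ 2 := by
    have he : deriv ζ =ᶠ[nhds z] fun x => -1 / w x := by
      filter_upwards [isOpen_Ioi.mem_nhds hz] with x hx using key x hx
    rw [he.deriv_eq]
    have h := (hasDerivAt_const z (-1 : ℂ)).div (hd1 z hz) hwz
    have h' : deriv (fun x => -1 / w x) z = _ := h.deriv
    rw [h']
    simp
  rw [hdd, key z hz, hζ, hp]
  field_simp
  ring
end

section
/- Let ζ : (0,∞) → ℂ be smooth with ζ'(z) ≠ 0 and ζ''(z) ≠ 0 for all z > 0, and suppose ζ satisfies the ζ-form equation (zζ'')² = 4(ζ')²(ζ − zζ') − 4ζ' on (0,∞). Then its Bäcklund transform ζ₁ := ζ + zζ''/(2ζ') + 1/4 also satisfies the ζ-form equation (zζ₁'')² = 4(ζ₁')²(ζ₁ − zζ₁') − 4ζ₁' on (0,∞), and moreover z·ζ'(z)·ζ₁'(z) = 1 for all z > 0. -/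
theorem backlund_transform_solves_zeta_form
    (ζ : ℝ → ℂ) (hζ : ContDiffOn ℝ (⊤ : ℕ∞) ζ (Set.Ioi 0))
    (hζ' : ∀ z ∈ Set.Ioi (0:ℝ), deriv ζ z ≠ 0)
    (hζ'' : ∀ z ∈ Set.Ioi (0:ℝ), deriv (deriv ζ) z ≠ 0)
    (hzeta : ∀ z ∈ Set.Ioi (0:ℝ),
      ((z : ℂ) * deriv (deriv ζ) z) ^ 2
        = 4 * (deriv ζ z) ^ 2 * (ζ z - (z : ℂ) * deriv ζ z) - 4 * deriv ζ z)
    (ζ₁ : ℝ → ℂ)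
    (hζ₁ : ζ₁ = fun z => ζ z + (z : ℂ) * deriv (deriv ζ) z / (2 * deriv ζ z) + 1 / 4) :
    ∀ z ∈ Set.Ioi (0:ℝ),
      ((z : ℂ) * deriv (deriv ζ₁) z) ^ 2
        = 4 * (deriv ζ₁ z) ^ 2 * (ζ₁ z - (z : ℂ) * deriv ζ₁ z) - 4 * deriv ζ₁ z ∧
      (z : ℂ) * deriv ζ z * deriv ζ₁ z = 1 := by
  have hopen : IsOpen (Set.Ioi (0:ℝ)) := isOpen_Ioi
  have h1 : ContDiffOn ℝ (⊤ : ℕ∞) (deriv ζ) (Set.Ioi 0) :=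
    hζ.deriv_of_isOpen hopen (by simp)
  have h2 : ContDiffOn ℝ (⊤ : ℕ∞) (deriv (deriv ζ)) (Set.Ioi 0) :=
    h1.deriv_of_isOpen hopen (by simp)
  have hd : ∀ f : ℝ → ℂ, ContDiffOn ℝ (⊤ : ℕ∞) f (Set.Ioi 0) →
      ∀ z ∈ Set.Ioi (0:ℝ), HasDerivAt f (deriv f z) z := fun f hf z hz =>
    ((hf.differentiableOn (by simp)).differentiableAt (hopen.mem_nhds hz)).hasDerivAt
  have hid : ∀ z : ℝ, HasDerivAt (fun z : ℝ => (z : ℂ)) 1 z := fun z =>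
    Complex.ofRealCLM.hasDerivAt (x := z)
  -- the third-order consequence of the equation
  have h3 : ∀ z ∈ Set.Ioi (0:ℝ), (z : ℂ) * deriv (deriv ζ) z + (z : ℂ) ^ 2 * deriv (deriv (deriv ζ)) z
      = 4 * deriv ζ z * (ζ z - z * deriv ζ z) - 2 * z * (deriv ζ z) ^ 2 - 2 := by
    intro z hz
    have ha := hd _ hζ z hz
    have hb := hd _ h1 z hz
    have hc := hd _ h2 z hz
    have hL := ((hid z).mul hc).pow 2
    have hR := (((hb.pow 2).const_mul 4).mul (ha.sub ((hid z).mul hb))).sub (hb.const_mul 4)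
    have he := hL.congr_of_eventuallyEq (f₁ := _) (Filter.EventuallyEq.symm
      (Filter.eventuallyEq_of_mem (hopen.mem_nhds hz) hzeta))
    have hu := he.unique hR
    simp only [Pi.mul_apply, Pi.pow_apply, Pi.sub_apply] at hu
    push_cast at hu
    have hc0 := hζ'' z hz
    apply mul_left_cancel₀ (mul_ne_zero two_ne_zero hc0)
    linear_combination hu
  have hz0 : ∀ z ∈ Set.Ioi (0:ℝ), (z : ℂ) ≠ 0 := fun z hz =>
    Complex.ofReal_ne_zero.mpr (ne_of_gt hz)
  have h4 : ∀ z ∈ Set.Ioi (0:ℝ), deriv ζ₁ z = ((z : ℂ) * deriv ζ z)⁻¹ := by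
    intro z hz
    have ha := hd _ hζ z hz
    have hb := hd _ h1 z hz
    have hc := hd _ h2 z hz
    have hb0 := hζ' z hz
    have hD := (ha.add (((hid z).mul hc).div (hb.const_mul 2)
        (mul_ne_zero two_ne_zero hb0))).add_const (1 / 4)
    have hE := hD.congr_of_eventuallyEq (f₁ := ζ₁) (Filter.Eventually.of_forall (fun x => by
      rw [hζ₁]; rfl))
    rw [hE.deriv]
    have hzz := hz0 z hz
    have e1 := hzeta z hz
    have e2 := h3 z hz
    simp only [Pi.mul_apply]
    field_simp
    linear_combination deriv ζ z * e2 - e1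
  intro z hz
  have hb := hd _ h1 z hz
  have hb0 := hζ' z hz
  have hzz := hz0 z hz
  have e1 := hzeta z hz
  have h5 : deriv (deriv ζ₁) z
      = -(deriv ζ z + z * deriv (deriv ζ) z) / ((z : ℂ) * deriv ζ z) ^ 2 := by
    have hD := ((hid z).mul hb).inv (mul_ne_zero hzz hb0)
    have he := hD.congr_of_eventuallyEq
      (Filter.eventuallyEq_of_mem (hopen.mem_nhds hz) h4)
    rw [he.deriv]
    simp
  rw [h5, h4 z hz, hζ₁]
  refine ⟨?_, ?_⟩
  · field_simp
    linear_combination 2 * e1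
  · field_simp
end

section
/- Let ζ : (0,∞) → ℂ be smooth with ζ''(z) ≠ 0 for all z > 0, satisfying the ζ-form equation (zζ'')² = 4(ζ')²(ζ − zζ') − 4ζ' on (0,∞), and let τ : (0,∞) → ℂ be smooth, nowhere vanishing, with zτ'(z) = ζ(z)τ(z). Then τ satisfies the τ-form of the Painlevé III(D8) equation: (1/2)D⁴(τ,τ) − (z·d/dz)(D²(τ,τ)) + (1/2)D²(τ,τ) + 2z·τ² = 0 on (0,∞). -/
/-- The Euler operator `δ = z·d/dz` acting on complex-valued functions of a real variable. -/
noncomputable def euler (f : ℝ → ℂ) : ℝ → ℂ := fun z => (z : ℂ) * deriv f z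

/-- The Hirota operator `D^k(f,g) = Σ_{j=0}^k (−1)^{k−j} (k choose j) (δ^j f)(δ^{k−j} g)`
with respect to `log z`. -/
noncomputable def hirota (k : ℕ) (f g : ℝ → ℂ) : ℝ → ℂ := fun z =>
  ∑ j ∈ Finset.range (k + 1),
    (-1 : ℂ) ^ (k - j) * (k.choose j : ℂ) * (euler^[j] f z) * (euler^[k - j] g z)

theorem euler_step (f g g' : ℝ → ℂ) (h : ∀ z ∈ Set.Ioi (0:ℝ), f z = g z)
    (hg : ∀ z ∈ Set.Ioi (0:ℝ), HasDerivAt g (g' z) z) :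
    ∀ z ∈ Set.Ioi (0:ℝ), euler f z = (z : ℂ) * g' z := by
  intro z hz
  have he : f =ᶠ[nhds z] g := by
    filter_upwards [isOpen_Ioi.mem_nhds hz] with y hy using h y hy
  simp only [euler]
  rw [he.deriv_eq, (hg z hz).deriv]

theorem smooth_deriv (f : ℝ → ℂ) (h : ContDiffOn ℝ (⊤ : ℕ∞) f (Set.Ioi 0)) :
    ContDiffOn ℝ (⊤ : ℕ∞) (deriv f) (Set.Ioi 0) :=
  ((contDiffOn_infty_iff_deriv_of_isOpen isOpen_Ioi).1 h).2

theorem smooth_hasDerivAt (f : ℝ → ℂ) (h : ContDiffOn ℝ (⊤ : ℕ∞) f (Set.Ioi 0)) :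
    ∀ z ∈ Set.Ioi (0:ℝ), HasDerivAt f (deriv f z) z := fun z hz =>
  (((contDiffOn_infty_iff_deriv_of_isOpen isOpen_Ioi).1 h).1.differentiableAt
    (isOpen_Ioi.mem_nhds hz)).hasDerivAt

theorem tau_form_from_zeta_form
    (ζ : ℝ → ℂ) (hζ : ContDiffOn ℝ (⊤ : ℕ∞) ζ (Set.Ioi 0))
    (hζ'' : ∀ z ∈ Set.Ioi (0:ℝ), deriv (deriv ζ) z ≠ 0)
    (hzeta : ∀ z ∈ Set.Ioi (0:ℝ),
      ((z : ℂ) * deriv (deriv ζ) z) ^ 2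
        = 4 * (deriv ζ z) ^ 2 * (ζ z - (z : ℂ) * deriv ζ z) - 4 * deriv ζ z)
    (τ : ℝ → ℂ) (hτ : ContDiffOn ℝ (⊤ : ℕ∞) τ (Set.Ioi 0))
    (hτ0 : ∀ z ∈ Set.Ioi (0:ℝ), τ z ≠ 0)
    (hτζ : ∀ z ∈ Set.Ioi (0:ℝ), (z : ℂ) * deriv τ z = ζ z * τ z) :
    ∀ z ∈ Set.Ioi (0:ℝ),
      (1 / 2) * hirota 4 τ τ z - euler (hirota 2 τ τ) z
        + (1 / 2) * hirota 2 τ τ z + 2 * (z : ℂ) * (τ z) ^ 2 = 0 := by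
  have hp := smooth_deriv ζ hζ
  have hq := smooth_deriv _ hp
  have d0 := smooth_hasDerivAt ζ hζ
  have d1 := smooth_hasDerivAt _ hp
  have d2 := smooth_hasDerivAt _ hq
  have dt := smooth_hasDerivAt τ hτ
  have dz : ∀ z : ℝ, HasDerivAt (fun x : ℝ => (x : ℂ)) 1 z := fun z => by
    simpa using (hasDerivAt_id z).ofReal_comp
  generalize deriv (deriv (deriv ζ)) = r at *
  generalize deriv (deriv ζ) = q at *
  generalize deriv ζ = p at *
  have e1 : ∀ z ∈ Set.Ioi (0:ℝ), euler τ z = ζ z * τ z := fun z hz => hτζ z hz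
  have e2 : ∀ z ∈ Set.Ioi (0:ℝ), euler (euler τ) z = (z * p z + ζ z * ζ z) * τ z := by
    intro z hz
    rw [euler_step _ _ _ e1 (fun z hz => (d0 z hz).mul (dt z hz)) z hz]
    linear_combination ζ z * hτζ z hz
  have e3 : ∀ z ∈ Set.Ioi (0:ℝ), euler (euler (euler τ)) z =
      (z * p z + z * z * q z + 3 * (z * p z * ζ z) + ζ z * ζ z * ζ z) * τ z := by
    intro z hz
    rw [euler_step _ _ _ e2 (fun z hz => ((((dz z).mul (d1 z hz)).add
      ((d0 z hz).mul (d0 z hz))).mul (dt z hz))) z hz]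
    simp only [Pi.mul_apply, Pi.add_apply]
    linear_combination (z * p z + ζ z * ζ z) * hτζ z hz
  have e4 : ∀ z ∈ Set.Ioi (0:ℝ), euler (euler (euler (euler τ))) z =
      (z * p z + 3 * z ^ 2 * q z + z ^ 3 * r z + 4 * ζ z * (z * p z + z ^ 2 * q z)
        + 3 * (z * p z) ^ 2 + 6 * z * p z * ζ z ^ 2 + ζ z ^ 4) * τ z := by
    intro z hz
    rw [euler_step _ _ _ e3 (fun z hz => ((((((dz z).mul (d1 z hz)).add
      (((dz z).mul (dz z)).mul (d2 z hz))).add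
      ((((dz z).mul (d1 z hz)).mul (d0 z hz)).const_mul 3)).add
      (((d0 z hz).mul (d0 z hz)).mul (d0 z hz))).mul (dt z hz))) z hz]
    simp only [Pi.mul_apply, Pi.add_apply]
    linear_combination (z * p z + z * z * q z + 3 * (z * p z * ζ z) + ζ z * ζ z * ζ z) * hτζ z hz
  have h2 : ∀ z ∈ Set.Ioi (0:ℝ), hirota 2 τ τ z = 2 * (z * p z * (τ z * τ z)) := by
    intro z hz
    simp [hirota, Finset.sum_range_succ, e1 z hz, e2 z hz]
    ring
  have eh : ∀ z ∈ Set.Ioi (0:ℝ), euler (hirota 2 τ τ) z =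
      (2 * (z * p z + z ^ 2 * q z) + 4 * ζ z * z * p z) * τ z ^ 2 := by
    intro z hz
    rw [euler_step _ _ _ h2 (fun z hz => ((((dz z).mul (d1 z hz)).mul
      ((dt z hz).mul (dt z hz))).const_mul 2)) z hz]
    simp only [Pi.mul_apply, Pi.add_apply]
    linear_combination 4 * z * p z * τ z * hτζ z hz
  have key : ∀ z ∈ Set.Ioi (0:ℝ),
      z * q z + z ^ 2 * r z - 4 * p z * ζ z + 6 * z * p z ^ 2 + 2 = 0 := by
    intro z hz
    have hL := ((dz z).mul (d2 z hz)).mul ((dz z).mul (d2 z hz))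
    have hR := ((((d1 z hz).mul (d1 z hz)).const_mul 4).mul
      ((d0 z hz).sub ((dz z).mul (d1 z hz)))).sub ((d1 z hz).const_mul 4)
    have hE := hL.congr_of_eventuallyEq (f₁ := _) (by
      filter_upwards [isOpen_Ioi.mem_nhds hz] with y hy
      have := hzeta y hy
      show 4 * (p y * p y) * (ζ y - y * p y) - 4 * p y = (y * q y) * (y * q y)
      linear_combination -this)
    have hu := hR.unique hE
    simp only [Pi.mul_apply, Pi.add_apply, Pi.sub_apply] at hu
    have h0 := hζ'' z hz
    have : (2 * q z) * (z * q z + z ^ 2 * r z - 4 * p z * ζ z + 6 * z * p z ^ 2 + 2) = 0 := by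
      linear_combination -hu
    exact (mul_eq_zero.1 this).resolve_left (by simpa using h0)
  intro z hz
  rw [eh z hz, h2 z hz]
  simp [hirota, Finset.sum_range_succ, e1 z hz, e2 z hz, e3 z hz, e4 z hz, Nat.choose]
  linear_combination z * τ z ^ 2 * key z hz
end

section
/- Let τ : (0,∞) → ℂ be smooth, nowhere vanishing, and satisfy the τ-form equation (1/2)D⁴(τ,τ) − (z·d/dz)(D²(τ,τ)) + (1/2)D²(τ,τ) + 2z·τ² = 0 on (0,∞). Set ζ(z) := z·τ'(z)/τ(z) and assume ζ''(z) ≠ 0 for all z > 0. Then there exists a constant c₀ ∈ ℂ such that (zζ'')² = 4(ζ')²(ζ − zζ') − 4ζ' + c₀ on (0,∞); that is, ζ solves the ζ-form of a Painlevé III(D7) equation (with c₀ = 1/θ₊), and the Painlevé III(D8) case corresponds to c₀ = 0. -/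
lemma euler_of_eqOn {f g : ℝ → ℂ} (h : ∀ z ∈ Set.Ioi (0:ℝ), f z = g z) {z : ℝ}
    (hz : z ∈ Set.Ioi (0:ℝ)) {d : ℂ} (hg : HasDerivAt g d z) : euler f z = (z : ℂ) * d := by
  have h1 : f =ᶠ[nhds z] g := Filter.eventuallyEq_of_mem (isOpen_Ioi.mem_nhds hz) h
  unfold euler
  rw [(hg.congr_of_eventuallyEq h1).deriv]

theorem zeta_form_D7_from_tau_form
    (τ : ℝ → ℂ) (hτ : ContDiffOn ℝ (⊤ : ℕ∞) τ (Set.Ioi 0))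
    (hτ0 : ∀ z ∈ Set.Ioi (0:ℝ), τ z ≠ 0)
    (htau : ∀ z ∈ Set.Ioi (0:ℝ),
      (1 / 2) * hirota 4 τ τ z - euler (hirota 2 τ τ) z
        + (1 / 2) * hirota 2 τ τ z + 2 * (z : ℂ) * (τ z) ^ 2 = 0)
    (ζ : ℝ → ℂ) (hζ : ζ = fun z : ℝ => (z : ℂ) * deriv τ z / τ z)
    (hζ'' : ∀ z ∈ Set.Ioi (0:ℝ), deriv (deriv ζ) z ≠ 0) :
    ∃ c₀ : ℂ, ∀ z ∈ Set.Ioi (0:ℝ),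
      ((z : ℂ) * deriv (deriv ζ) z) ^ 2
        = 4 * (deriv ζ z) ^ 2 * (ζ z - (z : ℂ) * deriv ζ z) - 4 * deriv ζ z + c₀ := by
  have hS : IsOpen (Set.Ioi (0:ℝ)) := isOpen_Ioi
  have hofReal : ∀ z : ℝ, HasDerivAt (fun x : ℝ => (x : ℂ)) 1 z := fun z => Complex.ofRealCLM.hasDerivAt
  have hsm : ∀ f : ℝ → ℂ, ContDiffOn ℝ (⊤ : ℕ∞) f (Set.Ioi 0) →
      ContDiffOn ℝ (⊤ : ℕ∞) (deriv f) (Set.Ioi 0) := fun f hf =>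
    hf.deriv_of_isOpen hS (by simp)
  have hhd : ∀ f : ℝ → ℂ, ContDiffOn ℝ (⊤ : ℕ∞) f (Set.Ioi 0) → ∀ z ∈ Set.Ioi (0:ℝ),
      HasDerivAt f (deriv f z) z := fun f hf z hz =>
    ((hf.differentiableOn (by simp)).differentiableAt (hS.mem_nhds hz)).hasDerivAt
  have hζs : ContDiffOn ℝ (⊤ : ℕ∞) ζ (Set.Ioi 0) := by
    rw [hζ]
    simp only [div_eq_mul_inv]
    exact (Complex.ofRealCLM.contDiff.contDiffOn.mul (hsm τ hτ)).mul (hτ.inv hτ0)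
  have ht := hhd τ hτ
  have h0 := hhd ζ hζs
  have h1 := hhd _ (hsm _ hζs)
  have h2 := hhd _ (hsm _ (hsm _ hζs))
  have hτ' : ∀ z ∈ Set.Ioi (0:ℝ), (z : ℂ) * deriv τ z = τ z * ζ z := by
    intro z hz
    have := hτ0 z hz
    rw [hζ]; field_simp
  clear hζ
  generalize ha : deriv ζ = a at *
  generalize hb : deriv a = b at *
  generalize hc : deriv b = c at *
  have e1 : ∀ z ∈ Set.Ioi (0:ℝ), euler τ z = τ z * ζ z := hτ'
  have e2 : ∀ z ∈ Set.Ioi (0:ℝ), euler (euler τ) z = τ z * (ζ z * ζ z + z * a z) := by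
    intro z hz
    rw [euler_of_eqOn e1 hz ((ht z hz).mul (h0 z hz))]
    linear_combination (ζ z) * hτ' z hz
  have e3 : ∀ z ∈ Set.Ioi (0:ℝ), euler (euler (euler τ)) z
      = τ z * (ζ z * ζ z * ζ z + 3 * (z * (ζ z * a z)) + z * a z + z * (z * b z)) := by
    intro z hz
    rw [euler_of_eqOn e2 hz ((ht z hz).mul
      (((h0 z hz).mul (h0 z hz)).add ((hofReal z).mul (h1 z hz))))]
    try simp only [Pi.mul_apply, Pi.add_apply]
    linear_combination (ζ z * ζ z + z * a z) * hτ' z hz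
  have e4 : ∀ z ∈ Set.Ioi (0:ℝ), euler (euler (euler (euler τ))) z
      = τ z * (ζ z * (ζ z * ζ z * ζ z + 3 * (z * (ζ z * a z)) + z * a z + z * (z * b z))
        + z * (3 * ζ z ^ 2 * a z + 3 * ζ z * a z + 3 * z * a z ^ 2 + 3 * z * ζ z * b z
          + a z + 3 * z * b z + z ^ 2 * c z)) := by
    intro z hz
    have hd := (ht z hz).mul
      ((((((h0 z hz).mul (h0 z hz)).mul (h0 z hz)).add
        (((hofReal z).mul ((h0 z hz).mul (h1 z hz))).const_mul 3)).add
        ((hofReal z).mul (h1 z hz))).add ((hofReal z).mul ((hofReal z).mul (h2 z hz))))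
    rw [euler_of_eqOn e3 hz hd]
    simp only [Pi.mul_apply, Pi.add_apply]
    linear_combination (ζ z * ζ z * ζ z + 3 * (z * (ζ z * a z)) + z * a z + z * (z * b z))
      * hτ' z hz
  have hi2 : ∀ z ∈ Set.Ioi (0:ℝ), hirota 2 τ τ z = 2 * (τ z * τ z * (z * a z)) := by
    intro z hz
    simp [hirota, Finset.sum_range_succ, e1 z hz, e2 z hz]
    ring
  have ei2 : ∀ z ∈ Set.Ioi (0:ℝ), euler (hirota 2 τ τ) z
      = τ z ^ 2 * (4 * ζ z * (z * a z) + 2 * (z * a z + z ^ 2 * b z)) := by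
    intro z hz
    have hd := (((ht z hz).mul (ht z hz)).mul ((hofReal z).mul (h1 z hz))).const_mul 2
    rw [euler_of_eqOn hi2 hz hd]
    simp only [Pi.mul_apply]
    linear_combination (4 * τ z * z * a z) * hτ' z hz
  have hi4 : ∀ z ∈ Set.Ioi (0:ℝ), hirota 4 τ τ z
      = τ z ^ 2 * (2 * (z * a z + 3 * z ^ 2 * b z + z ^ 3 * c z) + 12 * (z * a z) ^ 2) := by
    intro z hz
    simp [hirota, Finset.sum_range_succ, e1 z hz, e2 z hz, e3 z hz, e4 z hz,
      show Nat.choose 4 2 = 6 from rfl, show Nat.choose 4 3 = 4 from rfl]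
    ring
  have key : ∀ z ∈ Set.Ioi (0:ℝ),
      z ^ 2 * c z + z * b z + 6 * z * a z ^ 2 - 4 * ζ z * a z + 2 = 0 := by
    intro z hz
    have h := htau z hz
    rw [hi4 z hz, ei2 z hz, hi2 z hz] at h
    have hz0 : (z : ℂ) ≠ 0 := by exact_mod_cast (ne_of_gt hz)
    have hne : τ z ^ 2 * (z : ℂ) ≠ 0 := mul_ne_zero (pow_ne_zero _ (hτ0 z hz)) hz0
    apply mul_left_cancel₀ hne
    linear_combination h
  let F : ℝ → ℂ := fun z => (z * b z) * (z * b z)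
    - 4 * (a z * a z * (ζ z - z * a z)) + 4 * a z
  have hF : ∀ z ∈ Set.Ioi (0:ℝ), HasDerivAt F 0 z := by
    intro z hz
    have hzb := (hofReal z).mul (h2 z hz)
    have hd := ((hzb.mul hzb).sub ((((h1 z hz).mul (h1 z hz)).mul
      ((h0 z hz).sub ((hofReal z).mul (h1 z hz)))).const_mul 4)).add ((h1 z hz).const_mul 4)
    refine hd.congr_deriv ?_
    simp only [Pi.mul_apply, Pi.sub_apply]
    linear_combination 2 * b z * key z hz
  refine ⟨F 1, fun z hz => ?_⟩
  have hFc : F z = F 1 := by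
    refine hS.is_const_of_deriv_eq_zero isPreconnected_Ioi
      (fun x hx => (hF x hx).differentiableAt.differentiableWithinAt)
      (fun x hx => (hF x hx).deriv) hz (by simp)
  rw [← hFc]
  simp only [F]
  ring
end

section
/- (Okamoto-like equations, direct part.) Let ζ : (0,∞) → ℂ be smooth with ζ' and ζ'' nowhere vanishing, satisfying the ζ-form equation (zζ'')² = 4(ζ')²(ζ − zζ') − 4ζ', and let ζ₁ := ζ + zζ''/(2ζ') + 1/4 be its Bäcklund transform. Let τ, τ₁ : (0,∞) → ℂ be smooth, nowhere vanishing, with zτ' = ζτ and zτ₁' = ζ₁τ₁. Then on (0,∞): D²(τ,τ₁) − (1/2)(z·d/dz − 1/8)(τ·τ₁) = 0 and D³(τ,τ₁) − (1/2)(z·d/dz − 1/8)D¹(τ,τ₁) = 0. -/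
lemma hasDerivAt_of_contDiffOn {f : ℝ → ℂ} (hf : ContDiffOn ℝ (⊤ : ℕ∞) f (Set.Ioi 0)) :
    ∀ z ∈ Set.Ioi (0:ℝ), HasDerivAt f (deriv f z) z := fun z hz =>
  ((hf.differentiableOn (by simp)).differentiableAt (isOpen_Ioi.mem_nhds hz)).hasDerivAt

lemma contDiffOn_deriv_Ioi {f : ℝ → ℂ} (hf : ContDiffOn ℝ (⊤ : ℕ∞) f (Set.Ioi 0)) :
    ContDiffOn ℝ (⊤ : ℕ∞) (deriv f) (Set.Ioi 0) :=
  hf.deriv_of_isOpen isOpen_Ioi (by norm_cast)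

lemma euler_eq_of_eqOn {f g : ℝ → ℂ} {g' : ℂ} {z : ℝ} (hz : z ∈ Set.Ioi (0:ℝ))
    (h : ∀ x ∈ Set.Ioi (0:ℝ), f x = g x) (hg : HasDerivAt g g' z) :
    euler f z = (z : ℂ) * g' := by
  have : f =ᶠ[nhds z] g := Filter.eventually_of_mem (isOpen_Ioi.mem_nhds hz) h
  unfold euler
  rw [this.deriv_eq, hg.deriv]

theorem okamoto_like_equations_direct
    (ζ : ℝ → ℂ) (hζ : ContDiffOn ℝ (⊤ : ℕ∞) ζ (Set.Ioi 0))
    (hζ' : ∀ z ∈ Set.Ioi (0:ℝ), deriv ζ z ≠ 0)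
    (hζ'' : ∀ z ∈ Set.Ioi (0:ℝ), deriv (deriv ζ) z ≠ 0)
    (hzeta : ∀ z ∈ Set.Ioi (0:ℝ),
      ((z : ℂ) * deriv (deriv ζ) z) ^ 2
        = 4 * (deriv ζ z) ^ 2 * (ζ z - (z : ℂ) * deriv ζ z) - 4 * deriv ζ z)
    (ζ₁ : ℝ → ℂ)
    (hζ₁ : ζ₁ = fun z => ζ z + (z : ℂ) * deriv (deriv ζ) z / (2 * deriv ζ z) + 1 / 4)
    (τ τ₁ : ℝ → ℂ)
    (hτ : ContDiffOn ℝ (⊤ : ℕ∞) τ (Set.Ioi 0)) (hτ₁ : ContDiffOn ℝ (⊤ : ℕ∞) τ₁ (Set.Ioi 0))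
    (hτ0 : ∀ z ∈ Set.Ioi (0:ℝ), τ z ≠ 0) (hτ₁0 : ∀ z ∈ Set.Ioi (0:ℝ), τ₁ z ≠ 0)
    (hτζ : ∀ z ∈ Set.Ioi (0:ℝ), (z : ℂ) * deriv τ z = ζ z * τ z)
    (hτ₁ζ₁ : ∀ z ∈ Set.Ioi (0:ℝ), (z : ℂ) * deriv τ₁ z = ζ₁ z * τ₁ z) :
    ∀ z ∈ Set.Ioi (0:ℝ),
      hirota 2 τ τ₁ z
        - (1 / 2) * (euler (fun x => τ x * τ₁ x) z - (1 / 8) * (τ z * τ₁ z)) = 0 ∧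
      hirota 3 τ τ₁ z
        - (1 / 2) * (euler (hirota 1 τ τ₁) z - (1 / 8) * hirota 1 τ τ₁ z) = 0 := by
  have hp := contDiffOn_deriv_Ioi hζ
  have hr := contDiffOn_deriv_Ioi hp
  have dζ := hasDerivAt_of_contDiffOn hζ
  have dp := hasDerivAt_of_contDiffOn hp
  have dr := hasDerivAt_of_contDiffOn hr
  have dτ := hasDerivAt_of_contDiffOn hτ
  have dτ₁ := hasDerivAt_of_contDiffOn hτ₁
  have did : ∀ z : ℝ, HasDerivAt (fun x : ℝ => (x : ℂ)) 1 z := fun z => Complex.ofRealCLM.hasDerivAt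
  have hz0 : ∀ z ∈ Set.Ioi (0:ℝ), (z : ℂ) ≠ 0 := fun z hz =>
    Complex.ofReal_ne_zero.mpr (ne_of_gt hz)
  generalize hP : deriv ζ = p at *
  generalize hR : deriv p = r at *
  -- third order equation
  have h3 : ∀ z ∈ Set.Ioi (0:ℝ), (z : ℂ) * (r z + z * deriv r z)
      = 4 * p z * (ζ z - z * p z) - 2 * z * p z ^ 2 - 2 := by
    intro z hz
    have e1 := ((did z).mul (dr z hz)).pow 2
    have e2 := ((((dp z hz).pow 2).const_mul 4).mul
      ((dζ z hz).sub ((did z).mul (dp z hz)))).sub ((dp z hz).const_mul 4)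
    have e3 := e1.congr_of_eventuallyEq (f₁ := fun z : ℝ =>
      4 * (p z) ^ 2 * (ζ z - (z : ℂ) * p z) - 4 * p z)
      (Filter.eventually_of_mem (isOpen_Ioi.mem_nhds hz) (fun x hx => (hzeta x hx).symm))
    have e4 := e3.unique e2
    simp only [Pi.mul_apply, Pi.pow_apply, Pi.sub_apply] at e4
    apply mul_left_cancel₀ (hζ'' z hz)
    push_cast at e4
    linear_combination e4 / 2
  have dζ₁ : ∀ z ∈ Set.Ioi (0:ℝ), HasDerivAt ζ₁ (1 / (z * p z)) z := by
    intro z hz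
    have e := ((dζ z hz).add (((did z).mul (dr z hz)).div ((dp z hz).const_mul 2)
      (mul_ne_zero two_ne_zero (hζ' z hz)))).add_const (1/4 : ℂ)
    rw [hζ₁]
    refine HasDerivAt.congr_deriv e ?_
    have := hζ' z hz
    have := hz0 z hz
    have e1 := h3 z hz
    have e2 := hzeta z hz
    simp only [Pi.mul_apply]
    field_simp
    linear_combination p z * e1 - e2
  have dq : ∀ z ∈ Set.Ioi (0:ℝ), HasDerivAt (fun x => 1 / p x) (- r z / p z ^ 2) z := by
    intro z hz
    have e := (dp z hz).inv (hζ' z hz)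
    simp only [one_div]
    exact e
  have dτ' : ∀ z ∈ Set.Ioi (0:ℝ), HasDerivAt τ (ζ z * τ z / z) z := by
    intro z hz
    refine (dτ z hz).congr_deriv ?_
    rw [← hτζ z hz, mul_div_cancel_left₀ _ (hz0 z hz)]
  have dτ₁' : ∀ z ∈ Set.Ioi (0:ℝ), HasDerivAt τ₁ (ζ₁ z * τ₁ z / z) z := by
    intro z hz
    refine (dτ₁ z hz).congr_deriv ?_
    rw [← hτ₁ζ₁ z hz, mul_div_cancel_left₀ _ (hz0 z hz)]
  have a1 : ∀ z ∈ Set.Ioi (0:ℝ), euler τ z = ζ z * τ z := hτζ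
  have b1 : ∀ z ∈ Set.Ioi (0:ℝ), euler τ₁ z = ζ₁ z * τ₁ z := hτ₁ζ₁
  have a2 : ∀ z ∈ Set.Ioi (0:ℝ), euler (euler τ) z = (ζ z ^ 2 + z * p z) * τ z := by
    intro z hz
    rw [euler_eq_of_eqOn hz a1 ((dζ z hz).mul (dτ' z hz))]
    have := hz0 z hz
    field_simp
    ring
  have b2 : ∀ z ∈ Set.Ioi (0:ℝ), euler (euler τ₁) z = (ζ₁ z ^ 2 + 1 / p z) * τ₁ z := by
    intro z hz
    rw [euler_eq_of_eqOn hz b1 ((dζ₁ z hz).mul (dτ₁' z hz))]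
    have := hz0 z hz
    have := hζ' z hz
    field_simp
    ring
  have a3 : ∀ z ∈ Set.Ioi (0:ℝ), euler (euler (euler τ)) z
      = (ζ z ^ 3 + 3 * ζ z * (z * p z) + z * p z + z ^ 2 * r z) * τ z := by
    intro z hz
    rw [euler_eq_of_eqOn hz a2
      ((((dζ z hz).pow 2).add ((did z).mul (dp z hz))).mul (dτ' z hz))]
    have := hz0 z hz
    simp only [Pi.mul_apply, Pi.pow_apply, Pi.add_apply]
    push_cast
    field_simp
    ring
  have b3 : ∀ z ∈ Set.Ioi (0:ℝ), euler (euler (euler τ₁)) z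
      = (ζ₁ z ^ 3 + 3 * ζ₁ z / p z - z * r z / p z ^ 2) * τ₁ z := by
    intro z hz
    rw [euler_eq_of_eqOn hz b2
      ((((dζ₁ z hz).pow 2).add (dq z hz)).mul (dτ₁' z hz))]
    have := hz0 z hz
    have := hζ' z hz
    simp only [Pi.mul_apply, Pi.pow_apply, Pi.add_apply]
    push_cast
    field_simp
    ring
  have c0 : ∀ z ∈ Set.Ioi (0:ℝ), euler (fun x => τ x * τ₁ x) z
      = (ζ z + ζ₁ z) * (τ z * τ₁ z) := by
    intro z hz
    rw [euler_eq_of_eqOn (f := fun x => τ x * τ₁ x) hz (fun _ _ => rfl) ((dτ' z hz).mul (dτ₁' z hz))]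
    have := hz0 z hz
    field_simp
  have c1 : ∀ z ∈ Set.Ioi (0:ℝ), hirota 1 τ τ₁ z = (ζ z - ζ₁ z) * (τ z * τ₁ z) := by
    intro z hz
    simp [hirota, Finset.sum_range_succ, a1 z hz, b1 z hz]
    ring
  have c2 : ∀ z ∈ Set.Ioi (0:ℝ), euler (hirota 1 τ τ₁) z
      = (z * p z - 1 / p z + (ζ z - ζ₁ z) * (ζ z + ζ₁ z)) * (τ z * τ₁ z) := by
    intro z hz
    rw [euler_eq_of_eqOn hz c1
      (((dζ z hz).sub (dζ₁ z hz)).mul ((dτ' z hz).mul (dτ₁' z hz)))]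
    have := hz0 z hz
    have := hζ' z hz
    simp only [Pi.mul_apply, Pi.sub_apply]
    field_simp
  intro z hz
  have hz' := hz0 z hz
  have hpz := hζ' z hz
  have e2 := hzeta z hz
  obtain ⟨u, hu⟩ : ∃ u, u = (z : ℂ) * r z / (2 * p z) := ⟨_, rfl⟩
  obtain ⟨v, hv⟩ : ∃ v, v = 1 / p z := ⟨_, rfl⟩
  have hb : ζ₁ z = ζ z + u + 1 / 4 := by rw [hζ₁, hu]
  have hvp : v * p z = 1 := by rw [hv]; field_simp
  have hzr : (z : ℂ) * r z = 2 * u * p z := by rw [hu]; field_simp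
  have huu : u ^ 2 = ζ z - z * p z - v := by
    rw [hu, hv]
    field_simp
    linear_combination e2
  have H2 : z * p z + v + (ζ z - ζ₁ z) ^ 2 = (ζ z + ζ₁ z) / 2 - 1 / 16 := by
    rw [hb]; linear_combination huu
  have b2' : euler (euler τ₁) z = (ζ₁ z ^ 2 + v) * τ₁ z := by rw [b2 z hz, hv]
  have b3' : euler (euler (euler τ₁)) z = (ζ₁ z ^ 3 + 3 * ζ₁ z * v - 2 * u * v) * τ₁ z := by
    rw [b3 z hz, hzr, hv]
    field_simp
  have a3' : euler (euler (euler τ)) z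
      = (ζ z ^ 3 + 3 * ζ z * (z * p z) + z * p z + 2 * u * (z * p z)) * τ z := by
    rw [a3 z hz]
    linear_combination z * τ z * hzr
  constructor
  · rw [c0 z hz]
    simp [hirota, Finset.sum_range_succ, a1 z hz, b1 z hz, a2 z hz, b2']
    linear_combination τ z * τ₁ z * H2
  · rw [c2 z hz, c1 z hz, ← hv]
    simp [hirota, Finset.sum_range_succ, a1 z hz, b1 z hz, a2 z hz, b2', a3', b3',
      show Nat.choose 3 2 = 3 from rfl]
    rw [hb] at H2 ⊢
    linear_combination τ z * τ₁ z * (-(u + 1/4)) * H2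
end

section
/- (Okamoto-like equations, converse part.) Let τ, τ₁ : (0,∞) → ℂ be smooth, nowhere vanishing, and satisfy on (0,∞) the Okamoto-like equations D²(τ,τ₁) − (1/2)(z·d/dz − 1/8)(τ·τ₁) = 0 and D³(τ,τ₁) − (1/2)(z·d/dz − 1/8)D¹(τ,τ₁) = 0. Set ζ := zτ'/τ and ζ₁ := zτ₁'/τ₁, and assume ζ', ζ₁', ζ'', ζ₁'' are nowhere vanishing on (0,∞). Then there exists a constant D ≠ 0 such that: z·ζ'(z)·ζ₁'(z) = D for all z > 0; both ζ and ζ₁ satisfy the rescaled ζ-form equation (zξ'')² = 4(ξ')²(ξ − zξ') − 4Dξ'; and ζ₁ = ζ + zζ''/(2ζ') + 1/4 (equivalently, after replacing z by z/D, the functions ζ(z/D) and ζ₁(z/D) solve the ζ-form equation and are related by the Bäcklund transformation). -/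
/-- Smoothness on the half line. -/
def SmP (f : ℝ → ℂ) : Prop := ContDiffOn ℝ (⊤ : ℕ∞) f (Set.Ioi 0)

lemma SmP.dAt {f : ℝ → ℂ} (hf : SmP f) {z : ℝ} (hz : 0 < z) : HasDerivAt f (deriv f z) z := by
  have h1 : ContDiffAt ℝ (⊤ : ℕ∞) f z := hf.contDiffAt (Ioi_mem_nhds hz)
  exact (h1.differentiableAt (by simp)).hasDerivAt

lemma SmP.deriv {f : ℝ → ℂ} (hf : SmP f) : SmP (deriv f) :=
  ((contDiffOn_infty_iff_deriv_of_isOpen isOpen_Ioi).1 hf).2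

lemma smP_id : SmP (fun z : ℝ => (z : ℂ)) :=
  (Complex.ofRealCLM.contDiff (n := (⊤ : ℕ∞))).contDiffOn

lemma SmP.euler {f : ℝ → ℂ} (hf : SmP f) : SmP (euler f) :=
  ContDiffOn.mul smP_id hf.deriv

lemma SmP.mul {f g : ℝ → ℂ} (hf : SmP f) (hg : SmP g) : SmP (fun z => f z * g z) :=
  ContDiffOn.mul hf hg

lemma SmP.add {f g : ℝ → ℂ} (hf : SmP f) (hg : SmP g) : SmP (fun z => f z + g z) :=
  ContDiffOn.add hf hg

lemma euler_mul' {f g : ℝ → ℂ} (hf : SmP f) (hg : SmP g) {z : ℝ} (hz : 0 < z) :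
    euler (fun z => f z * g z) z = euler f z * g z + f z * euler g z := by
  unfold _root_.euler
  rw [((hf.dAt hz).fun_mul (hg.dAt hz)).deriv]; ring

lemma euler_add' {f g : ℝ → ℂ} (hf : SmP f) (hg : SmP g) {z : ℝ} (hz : 0 < z) :
    euler (fun z => f z + g z) z = euler f z + euler g z := by
  unfold _root_.euler
  rw [((hf.dAt hz).fun_add (hg.dAt hz)).deriv]; ring

lemma euler_congr' {f g : ℝ → ℂ} (h : ∀ z : ℝ, 0 < z → f z = g z) {z : ℝ} (hz : 0 < z) :
    euler f z = euler g z := by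
  unfold _root_.euler
  have : f =ᶠ[nhds z] g := by
    filter_upwards [Ioi_mem_nhds hz] with x hx using h x hx
  rw [this.deriv_eq]

lemma tau_tower {f a : ℝ → ℂ} (hf : SmP f) (ha : SmP a)
    (h1 : ∀ z : ℝ, 0 < z → euler f z = a z * f z) :
    (∀ z : ℝ, 0 < z → euler (euler f) z = (euler a z + a z ^ 2) * f z) ∧
    (∀ z : ℝ, 0 < z → euler (euler (euler f)) z =
      (euler (euler a) z + 3 * a z * euler a z + a z ^ 3) * f z) := by
  have h2 : ∀ z : ℝ, 0 < z → euler (euler f) z = (euler a z + a z * a z) * f z := by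
    intro z hz
    rw [euler_congr' h1 hz, euler_mul' ha hf hz, h1 z hz]; ring
  refine ⟨fun z hz => by rw [h2 z hz]; ring, fun z hz => ?_⟩
  rw [euler_congr' h2 hz, euler_mul' (ha.euler.add (ha.mul ha)) hf hz,
    euler_add' ha.euler (ha.mul ha) hz, euler_mul' ha ha hz, h1 z hz]; ring

theorem okamoto_like_equations_converse
    (τ τ₁ : ℝ → ℂ)
    (hτ : ContDiffOn ℝ (⊤ : ℕ∞) τ (Set.Ioi 0)) (hτ₁ : ContDiffOn ℝ (⊤ : ℕ∞) τ₁ (Set.Ioi 0))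
    (hτ0 : ∀ z ∈ Set.Ioi (0:ℝ), τ z ≠ 0) (hτ₁0 : ∀ z ∈ Set.Ioi (0:ℝ), τ₁ z ≠ 0)
    (hOk1 : ∀ z ∈ Set.Ioi (0:ℝ),
      hirota 2 τ τ₁ z
        - (1 / 2) * (euler (fun x => τ x * τ₁ x) z - (1 / 8) * (τ z * τ₁ z)) = 0)
    (hOk2 : ∀ z ∈ Set.Ioi (0:ℝ),
      hirota 3 τ τ₁ z
        - (1 / 2) * (euler (hirota 1 τ τ₁) z - (1 / 8) * hirota 1 τ τ₁ z) = 0)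
    (ζ ζ₁ : ℝ → ℂ)
    (hζ : ζ = fun z : ℝ => (z : ℂ) * deriv τ z / τ z)
    (hζ₁ : ζ₁ = fun z : ℝ => (z : ℂ) * deriv τ₁ z / τ₁ z)
    (hζ' : ∀ z ∈ Set.Ioi (0:ℝ), deriv ζ z ≠ 0)
    (hζ₁' : ∀ z ∈ Set.Ioi (0:ℝ), deriv ζ₁ z ≠ 0)
    (hζ'' : ∀ z ∈ Set.Ioi (0:ℝ), deriv (deriv ζ) z ≠ 0)
    (hζ₁'' : ∀ z ∈ Set.Ioi (0:ℝ), deriv (deriv ζ₁) z ≠ 0) :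
    ∃ D : ℂ, D ≠ 0 ∧
      (∀ z ∈ Set.Ioi (0:ℝ), (z : ℂ) * deriv ζ z * deriv ζ₁ z = D) ∧
      (∀ z ∈ Set.Ioi (0:ℝ),
        ((z : ℂ) * deriv (deriv ζ) z) ^ 2
          = 4 * (deriv ζ z) ^ 2 * (ζ z - (z : ℂ) * deriv ζ z) - 4 * D * deriv ζ z) ∧
      (∀ z ∈ Set.Ioi (0:ℝ),
        ((z : ℂ) * deriv (deriv ζ₁) z) ^ 2
          = 4 * (deriv ζ₁ z) ^ 2 * (ζ₁ z - (z : ℂ) * deriv ζ₁ z) - 4 * D * deriv ζ₁ z) ∧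
      (∀ z ∈ Set.Ioi (0:ℝ),
        ζ₁ z = ζ z + (z : ℂ) * deriv (deriv ζ) z / (2 * deriv ζ z) + 1 / 4) := by
  have hT : SmP τ := hτ
  have hT₁ : SmP τ₁ := hτ₁
  have ha : SmP ζ := by
    simp only [hζ, div_eq_mul_inv]; exact ContDiffOn.mul hT.euler (ContDiffOn.inv hτ hτ0)
  have hb : SmP ζ₁ := by
    simp only [hζ₁, div_eq_mul_inv]; exact ContDiffOn.mul hT₁.euler (ContDiffOn.inv hτ₁ hτ₁0)
  have e1 : ∀ z : ℝ, 0 < z → euler τ z = ζ z * τ z := by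
    intro z hz
    have := hτ0 z hz
    rw [hζ]; simp only [euler]; field_simp
  have e1' : ∀ z : ℝ, 0 < z → euler τ₁ z = ζ₁ z * τ₁ z := by
    intro z hz
    have := hτ₁0 z hz
    rw [hζ₁]; simp only [euler]; field_simp
  obtain ⟨e2, e3⟩ := tau_tower hT ha e1
  obtain ⟨e2', e3'⟩ := tau_tower hT₁ hb e1'
  have hH1 : ∀ z : ℝ, 0 < z → hirota 1 τ τ₁ z = (ζ z + (-1) * ζ₁ z) * (τ z * τ₁ z) := by
    intro z hz
    simp [hirota, Finset.sum_range_succ, e1 z hz, e1' z hz]; ring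
  have hc : ∀ c : ℂ, SmP (fun _ => c) := fun c => contDiffOn_const
  have ec : ∀ (c : ℂ) (z : ℝ), euler (fun _ => c) z = 0 := fun c z => by simp [euler]
  -- first equation
  have q1 : ∀ z : ℝ, 0 < z → euler ζ z + euler ζ₁ z =
      (ζ z + (-1) * ζ₁ z) * (ζ₁ z + (-1) * ζ z) + ((1/2) * (ζ z + ζ₁ z) + (-1/16)) := by
    intro z hz
    have h := hOk1 z hz
    have n : τ z * τ₁ z ≠ 0 := mul_ne_zero (hτ0 z hz) (hτ₁0 z hz)
    rw [euler_mul' hT hT₁ hz] at h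
    simp [hirota, Finset.sum_range_succ, e1 z hz, e1' z hz, e2 z hz, e2' z hz] at h
    apply mul_left_cancel₀ n
    linear_combination h
  have hu : SmP (fun z => ζ z + (-1) * ζ₁ z) := ha.add ((hc _).mul hb)
  have hu' : SmP (fun z => ζ₁ z + (-1) * ζ z) := hb.add ((hc _).mul ha)
  have q2 : ∀ z : ℝ, 0 < z → euler (euler ζ) z - euler (euler ζ₁) z =
      (1/2) * (euler ζ z - euler ζ₁ z) - 2 * (ζ z - ζ₁ z) * (euler ζ z + euler ζ₁ z) := by
    intro z hz
    have h := hOk2 z hz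
    have n : τ z * τ₁ z ≠ 0 := mul_ne_zero (hτ0 z hz) (hτ₁0 z hz)
    rw [euler_congr' hH1 hz, euler_mul' hu (hT.mul hT₁) hz, euler_mul' hT hT₁ hz,
      euler_add' ha ((hc _).mul hb) hz, euler_mul' (hc _) hb hz, ec, hH1 z hz] at h
    simp [hirota, Finset.sum_range_succ, e1 z hz, e1' z hz, e2 z hz, e2' z hz,
      e3 z hz, e3' z hz, Nat.choose] at h
    apply mul_left_cancel₀ n
    linear_combination h - (τ z * τ₁ z) * (ζ z - ζ₁ z) * q1 z hz
  have q3 : ∀ z : ℝ, 0 < z → euler (euler ζ) z + euler (euler ζ₁) z =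
      (1/2) * (euler ζ z + euler ζ₁ z) - 2 * (ζ z - ζ₁ z) * (euler ζ z - euler ζ₁ z) := by
    intro z hz
    have h := euler_congr' q1 hz
    rw [euler_add' ha.euler hb.euler hz, euler_add' (hu.mul hu')
      (((hc _).mul (ha.add hb)).add (hc _)) hz, euler_mul' hu hu' hz,
      euler_add' ((hc _).mul (ha.add hb)) (hc _) hz, euler_mul' (hc _) (ha.add hb) hz,
      euler_add' ha hb hz, euler_add' ha ((hc _).mul hb) hz, euler_add' hb ((hc _).mul ha) hz,
      euler_mul' (hc _) ha hz, euler_mul' (hc _) hb hz, ec, ec, ec] at h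
    linear_combination h
  have ee : ∀ f : ℝ → ℂ, SmP f → ∀ z : ℝ, 0 < z →
      euler (euler f) z = z * (deriv f z + z * deriv (deriv f) z) := by
    intro f hf z hz
    have : euler (euler f) z = euler (fun z : ℝ => (z : ℂ) * deriv f z) z := rfl
    rw [this, euler_mul' smP_id hf.deriv hz]
    have h1 : deriv (fun z : ℝ => (z : ℂ)) z = 1 := (Complex.ofRealCLM.hasDerivAt (x := z)).deriv
    simp only [euler, h1]; ring
  have r1 : ∀ z : ℝ, 0 < z → z * deriv (deriv ζ) z = deriv ζ z * (-1/2 - 2 * (ζ z - ζ₁ z)) := by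
    intro z hz
    have n : (z : ℂ) ≠ 0 := by exact_mod_cast hz.ne'
    have h2 := q2 z hz
    have h3 := q3 z hz
    rw [ee ζ ha z hz, ee ζ₁ hb z hz] at h2 h3
    simp only [euler] at h2 h3
    apply mul_left_cancel₀ n
    linear_combination (h2 + h3) / 2
  have r2 : ∀ z : ℝ, 0 < z →
      z * deriv (deriv ζ₁) z = deriv ζ₁ z * (-1/2 + 2 * (ζ z - ζ₁ z)) := by
    intro z hz
    have n : (z : ℂ) ≠ 0 := by exact_mod_cast hz.ne'
    have h2 := q2 z hz
    have h3 := q3 z hz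
    rw [ee ζ ha z hz, ee ζ₁ hb z hz] at h2 h3
    simp only [euler] at h2 h3
    apply mul_left_cancel₀ n
    linear_combination (h3 - h2) / 2
  have hW : ∀ z ∈ Set.Ioi (0:ℝ), (z : ℂ) * deriv ζ z * deriv ζ₁ z
      = ((1:ℝ) : ℂ) * deriv ζ 1 * deriv ζ₁ 1 := by
    intro z hz
    have hd : ∀ x : ℝ, 0 < x → HasDerivAt (fun z : ℝ => (z : ℂ) * deriv ζ z * deriv ζ₁ z) 0 x := by
      intro x hx
      have h := ((Complex.ofRealCLM.hasDerivAt (x := x)).fun_mul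
        (ha.deriv.dAt hx)).fun_mul (hb.deriv.dAt hx)
      have o : Complex.ofRealCLM (1:ℝ) = 1 := by simp
      have o2 : Complex.ofRealCLM x = (x : ℂ) := rfl
      have h0 : (Complex.ofRealCLM 1 * deriv ζ x + Complex.ofRealCLM x * deriv (deriv ζ) x)
          * deriv ζ₁ x + Complex.ofRealCLM x * deriv ζ x * deriv (deriv ζ₁) x = 0 := by
        rw [o, o2]
        linear_combination deriv ζ₁ x * r1 x hx + deriv ζ x * r2 x hx
      rw [h0] at h
      exact h
    exact isOpen_Ioi.is_const_of_deriv_eq_zero isPreconnected_Ioi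
      (f := fun z : ℝ => (z : ℂ) * deriv ζ z * deriv ζ₁ z)
      (fun x hx => (hd x hx).differentiableAt.differentiableWithinAt)
      (fun x hx => (hd x hx).deriv) hz (Set.mem_Ioi.2 one_pos)
  have p1 : (1:ℝ) ∈ Set.Ioi (0:ℝ) := Set.mem_Ioi.2 one_pos
  refine ⟨((1:ℝ) : ℂ) * deriv ζ 1 * deriv ζ₁ 1, ?_, hW, ?_, ?_, ?_⟩
  · simpa using ⟨hζ' 1 p1, hζ₁' 1 p1⟩
  · intro z hz
    have h := q1 z hz
    simp only [euler] at h
    rw [← hW z hz, r1 z hz]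
    linear_combination (-4 * deriv ζ z ^ 2) * -h
  · intro z hz
    have h := q1 z hz
    simp only [euler] at h
    rw [← hW z hz, r2 z hz]
    linear_combination (-4 * deriv ζ₁ z ^ 2) * -h
  · intro z hz
    have n := hζ' z hz
    rw [r1 z hz]
    field_simp
    ring
end

section
/- (Toda-like equations, direct part.) Let ζ : (0,∞) → ℂ be smooth with ζ' and ζ'' nowhere vanishing, satisfying the ζ-form equation (zζ'')² = 4(ζ')²(ζ − zζ') − 4ζ', and let ζ₁ := ζ + zζ''/(2ζ') + 1/4 be its Bäcklund transform. Let τ, τ₁ : (0,∞) → ℂ be smooth, nowhere vanishing, with zτ' = ζτ and zτ₁' = ζ₁τ₁. Then there exists a constant C ≠ 0 such that on (0,∞): D²(τ,τ) = 2C·z^{1/2}·τ₁² and D²(τ₁,τ₁) = 2C^{−1}·z^{1/2}·τ². -/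
theorem hirota_two_aux (f g : ℝ → ℂ) (z : ℝ) (hz : 0 < z) (g' : ℂ)
    (hf : DifferentiableAt ℝ f z) (hg : HasDerivAt g g' z)
    (h : ∀ z ∈ Set.Ioi (0:ℝ), (z : ℂ) * deriv f z = g z * f z) :
    hirota 2 f f z = 2 * (f z) ^ 2 * ((z : ℂ) * g') := by
  have hev : euler f =ᶠ[nhds z] fun w => g w * f w := by
    filter_upwards [Ioi_mem_nhds hz] with w hw
    exact h w hw
  have hd : deriv (euler f) z = g' * f z + g z * deriv f z := by
    rw [hev.deriv_eq]
    exact (hg.mul hf.hasDerivAt).deriv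
  have h1 : euler f z = g z * f z := h z hz
  have h2 : euler (euler f) z = (z : ℂ) * (g' * f z + g z * deriv f z) := by
    rw [← hd]; rfl
  have h0 := h z hz
  simp only [hirota, Finset.sum_range_succ, Finset.sum_range_zero, Function.iterate_succ,
    Function.iterate_zero, Function.comp, id, Nat.reduceSub, Nat.choose, h1, h2]
  norm_num
  linear_combination (2 * f z * g z) * h0

theorem toda_like_equations_direct
    (ζ : ℝ → ℂ) (hζ : ContDiffOn ℝ (⊤ : ℕ∞) ζ (Set.Ioi 0))
    (hζ' : ∀ z ∈ Set.Ioi (0:ℝ), deriv ζ z ≠ 0)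
    (hζ'' : ∀ z ∈ Set.Ioi (0:ℝ), deriv (deriv ζ) z ≠ 0)
    (hzeta : ∀ z ∈ Set.Ioi (0:ℝ),
      ((z : ℂ) * deriv (deriv ζ) z) ^ 2
        = 4 * (deriv ζ z) ^ 2 * (ζ z - (z : ℂ) * deriv ζ z) - 4 * deriv ζ z)
    (ζ₁ : ℝ → ℂ)
    (hζ₁ : ζ₁ = fun z => ζ z + (z : ℂ) * deriv (deriv ζ) z / (2 * deriv ζ z) + 1 / 4)
    (τ τ₁ : ℝ → ℂ)
    (hτ : ContDiffOn ℝ (⊤ : ℕ∞) τ (Set.Ioi 0)) (hτ₁ : ContDiffOn ℝ (⊤ : ℕ∞) τ₁ (Set.Ioi 0))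
    (hτ0 : ∀ z ∈ Set.Ioi (0:ℝ), τ z ≠ 0) (hτ₁0 : ∀ z ∈ Set.Ioi (0:ℝ), τ₁ z ≠ 0)
    (hτζ : ∀ z ∈ Set.Ioi (0:ℝ), (z : ℂ) * deriv τ z = ζ z * τ z)
    (hτ₁ζ₁ : ∀ z ∈ Set.Ioi (0:ℝ), (z : ℂ) * deriv τ₁ z = ζ₁ z * τ₁ z) :
    ∃ C : ℂ, C ≠ 0 ∧
      (∀ z ∈ Set.Ioi (0:ℝ),
        hirota 2 τ τ z = 2 * C * (Real.sqrt z : ℂ) * (τ₁ z) ^ 2) ∧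
      (∀ z ∈ Set.Ioi (0:ℝ),
        hirota 2 τ₁ τ₁ z = 2 * C⁻¹ * (Real.sqrt z : ℂ) * (τ z) ^ 2) := by
  have dd : ∀ (f : ℝ → ℂ), ContDiffOn ℝ (⊤ : ℕ∞) f (Set.Ioi 0) →
      ContDiffOn ℝ (⊤ : ℕ∞) (deriv f) (Set.Ioi 0) := fun f hf =>
    hf.deriv_of_isOpen isOpen_Ioi (by simp)
  have da : ∀ (f : ℝ → ℂ), ContDiffOn ℝ (⊤ : ℕ∞) f (Set.Ioi 0) →
      ∀ z ∈ Set.Ioi (0:ℝ), HasDerivAt f (deriv f z) z := fun f hf z hz =>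
    (((hf.differentiableOn (by simp)) z hz).differentiableAt (Ioi_mem_nhds hz)).hasDerivAt
  have d0 := da ζ hζ
  have d1 := da _ (dd ζ hζ)
  have d2 := da _ (dd _ (dd ζ hζ))
  have dτ := da τ hτ
  have dτ₁ := da τ₁ hτ₁
  have did : ∀ z : ℝ, HasDerivAt (fun w : ℝ => (w : ℂ)) 1 z := fun z =>
    Complex.ofRealCLM.hasDerivAt
  have hz0 : ∀ z ∈ Set.Ioi (0:ℝ), (z : ℂ) ≠ 0 := fun z hz =>
    Complex.ofReal_ne_zero.mpr (ne_of_gt hz)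
  -- differentiated equation
  have third : ∀ z ∈ Set.Ioi (0:ℝ),
      (z : ℂ) * (deriv (deriv ζ) z + z * deriv (deriv (deriv ζ)) z)
        = 4 * deriv ζ z * (ζ z - z * deriv ζ z) - 2 * z * (deriv ζ z) ^ 2 - 2 := by
    intro z hz
    have L := (((did z).mul (d2 z hz)).pow 2)
    have R := ((((d1 z hz).pow 2).const_mul 4).mul
      ((d0 z hz).sub ((did z).mul (d1 z hz)))).sub ((d1 z hz).const_mul 4)
    have E := L.unique (R.congr_of_eventuallyEq (by
      filter_upwards [Ioi_mem_nhds hz] with w hw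
      exact hzeta w hw))
    simp at E
    apply mul_left_cancel₀ (hζ'' z hz)
    linear_combination E / 2
  have dz1 : ∀ z ∈ Set.Ioi (0:ℝ), HasDerivAt ζ₁ (1 / (z * deriv ζ z)) z := by
    intro z hz
    have p0 := hζ' z hz
    have zz := hz0 z hz
    have H := (((d0 z hz).add (((did z).mul (d2 z hz)).div ((d1 z hz).const_mul 2)
      (mul_ne_zero two_ne_zero p0))).add_const (1/4))
    rw [hζ₁]
    refine H.congr_deriv ?_
    have t := third z hz
    have e := hzeta z hz
    simp only [Pi.mul_apply]
    field_simp
    linear_combination deriv ζ z * t - e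
  have hs : ∀ z ∈ Set.Ioi (0:ℝ), (Real.sqrt z : ℂ) ≠ 0 := fun z hz =>
    Complex.ofReal_ne_zero.mpr (Real.sqrt_pos.mpr hz).ne'
  have hss : ∀ z ∈ Set.Ioi (0:ℝ), (Real.sqrt z : ℂ) ^ 2 = z := fun z hz => by
    rw [← Complex.ofReal_pow, Real.sq_sqrt (le_of_lt hz)]
  let R : ℝ → ℂ := fun z => (Real.sqrt z : ℂ) * deriv ζ z * (τ z) ^ 2 / (τ₁ z) ^ 2
  have dR : ∀ z ∈ Set.Ioi (0:ℝ), HasDerivAt R 0 z := by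
    intro z hz
    have dsq : HasDerivAt (fun w : ℝ => (Real.sqrt w : ℂ)) ((1 / (2 * Real.sqrt z) : ℝ) : ℂ) z :=
      (Real.hasDerivAt_sqrt (ne_of_gt hz)).ofReal_comp
    have H := ((dsq.mul (d1 z hz)).mul ((dτ z hz).pow 2)).div ((dτ₁ z hz).pow 2)
      (pow_ne_zero 2 (hτ₁0 z hz))
    refine H.congr_deriv ?_
    have p0 := hζ' z hz
    have zz := hz0 z hz
    have t0 := hτ₁0 z hz
    have s0 := hs z hz
    have e1 : deriv τ z = ζ z * τ z / z := by rw [← hτζ z hz]; field_simp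
    have e2 : deriv τ₁ z = ζ₁ z * τ₁ z / z := by rw [← hτ₁ζ₁ z hz]; field_simp
    rw [e1, e2, hζ₁]
    simp only [Pi.mul_apply, Pi.pow_apply]
    push_cast
    have q := hss z hz
    generalize (Real.sqrt z : ℂ) = s at *
    rw [← q]
    field_simp
    ring
  have hR : ∀ z ∈ Set.Ioi (0:ℝ), R z = R 1 := fun z hz =>
    isOpen_Ioi.is_const_of_deriv_eq_zero isPreconnected_Ioi
      (fun w hw => (dR w hw).differentiableAt.differentiableWithinAt)
      (fun w hw => (dR w hw).deriv) hz (by simp)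
  have hR0 : ∀ z ∈ Set.Ioi (0:ℝ), R z ≠ 0 := fun z hz =>
    div_ne_zero (mul_ne_zero (mul_ne_zero (hs z hz) (hζ' z hz)) (pow_ne_zero 2 (hτ0 z hz)))
      (pow_ne_zero 2 (hτ₁0 z hz))
  refine ⟨R 1, hR0 1 (by simp), ?_, ?_⟩
  · intro z hz
    rw [hirota_two_aux τ ζ z hz _ (dτ z hz).differentiableAt (d0 z hz) hτζ, ← hR z hz]
    have t0 := hτ₁0 z hz
    simp only [R]
    rw [← hss z hz]
    field_simp
  · intro z hz
    rw [hirota_two_aux τ₁ ζ₁ z hz _ (dτ₁ z hz).differentiableAt (dz1 z hz) hτ₁ζ₁, ← hR z hz]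
    have t0 := hτ₁0 z hz
    have t1 := hτ0 z hz
    have s0 := hs z hz
    have p0 := hζ' z hz
    have zz := hz0 z hz
    simp only [R]
    field_simp
end

section
/- (Toda-like equations, converse part.) Let C ∈ ℂ, C ≠ 0, and let τ, τ₁ : (0,∞) → ℂ be smooth, nowhere vanishing, satisfying D²(τ,τ) = 2C·z^{1/2}·τ₁² and D²(τ₁,τ₁) = 2C^{−1}·z^{1/2}·τ² on (0,∞). Set ζ := zτ'/τ and ζ₁ := zτ₁'/τ₁, and assume ζ'' and ζ₁'' are nowhere vanishing. Then z·ζ'(z)·ζ₁'(z) = 1 for all z > 0, and there exists a constant K ∈ ℂ such that ζ − K and ζ₁ − K both satisfy the ζ-form equation, i.e. (zζ'')² = 4(ζ')²(ζ − K − zζ') − 4ζ' and (zζ₁'')² = 4(ζ₁')²(ζ₁ − K − zζ₁') − 4ζ₁', and moreover ζ₁ = ζ + zζ''/(2ζ') + 1/4 (so π(ζ − K) = ζ₁ − K). -/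
theorem toda_aux_euler2 (f : ℝ → ℂ) (z : ℝ) (f2 : ℂ) (h : HasDerivAt (deriv f) f2 z) :
    euler (euler f) z = z * (deriv f z + z * f2) := by
  have h1 : HasDerivAt (euler f) (1 * deriv f z + (z : ℂ) * f2) z :=
    (HasDerivAt.ofReal_comp (hasDerivAt_id z)).mul h |>.congr_deriv (by simp)
  have h2 : euler (euler f) z = z * deriv (euler f) z := rfl
  rw [h2, h1.deriv, one_mul]

theorem toda_aux_hirota (f : ℝ → ℂ) (z : ℝ) (f2 : ℂ) (h : HasDerivAt (deriv f) f2 z) :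
    hirota 2 f f z = 2 * (f z * (z * (deriv f z + z * f2)) - (z * deriv f z) ^ 2) := by
  have h2 := toda_aux_euler2 f z f2 h
  have h1 : euler f z = z * deriv f z := rfl
  simp only [hirota, Finset.sum_range_succ, Finset.sum_range_zero, Function.iterate_succ,
    Function.iterate_zero, Function.comp, id, h2, h1]
  simp [Nat.choose, h2, h1]
  ring

theorem toda_aux_pair (C : ℂ) (f g : ℝ → ℂ)
    (hf : ContDiffOn ℝ (⊤ : ℕ∞) f (Set.Ioi 0)) (hg : ContDiffOn ℝ (⊤ : ℕ∞) g (Set.Ioi 0))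
    (hf0 : ∀ z ∈ Set.Ioi (0:ℝ), f z ≠ 0) (hg0 : ∀ z ∈ Set.Ioi (0:ℝ), g z ≠ 0)
    (hT : ∀ z ∈ Set.Ioi (0:ℝ), hirota 2 f f z = 2 * C * (Real.sqrt z : ℂ) * (g z) ^ 2)
    (x y : ℝ → ℂ)
    (hx : x = fun z : ℝ => (z : ℂ) * deriv f z / f z)
    (hy : y = fun z : ℝ => (z : ℂ) * deriv g z / g z) (z : ℝ) (hz : 0 < z) :
    HasDerivAt x (C * (Real.sqrt z : ℂ) * (g z) ^ 2 / ((f z) ^ 2 * z)) z ∧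
    HasDerivAt (deriv x)
      (C * (Real.sqrt z : ℂ) * (g z) ^ 2 / ((f z) ^ 2 * z) * (-1 / 2 + 2 * (y z - x z)) / z) z := by
  have hd : ∀ (k : ℝ → ℂ), ContDiffOn ℝ (⊤ : ℕ∞) k (Set.Ioi 0) → ∀ w : ℝ, 0 < w →
      HasDerivAt k (deriv k w) w ∧ HasDerivAt (deriv k) (deriv (deriv k) w) w := by
    intro k hk w hw
    have h1 : ContDiffOn ℝ (⊤ : ℕ∞) (deriv k) (Set.Ioi 0) :=
      hk.deriv_of_isOpen isOpen_Ioi (by simp)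
    have hn : Set.Ioi (0:ℝ) ∈ nhds w := Ioi_mem_nhds hw
    exact ⟨((hk.differentiableOn (by simp)).differentiableAt hn).hasDerivAt,
      ((h1.differentiableOn (by simp)).differentiableAt hn).hasDerivAt⟩
  have hid : ∀ w : ℝ, HasDerivAt (fun t : ℝ => (t : ℂ)) 1 w := fun w =>
    (HasDerivAt.ofReal_comp (hasDerivAt_id w)).congr_deriv (by simp)
  have key : ∀ w : ℝ, 0 < w →
      HasDerivAt x (C * (Real.sqrt w : ℂ) * (g w) ^ 2 / ((f w) ^ 2 * w)) w := by
    intro w hw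
    obtain ⟨h1, h2⟩ := hd f hf w hw
    have hw0 : (w : ℂ) ≠ 0 := by exact_mod_cast hw.ne'
    have hfw := hf0 w hw
    have hT' := hT w hw
    rw [toda_aux_hirota f w _ h2] at hT'
    rw [hx]
    refine (((hid w).mul h2).div h1 hfw).congr_deriv ?_
    rw [div_eq_div_iff (by positivity) (by positivity)]
    simp only [Pi.mul_apply]
    linear_combination (f w) ^ 2 / 2 * hT'
  refine ⟨key z hz, ?_⟩
  have heq : deriv x =ᶠ[nhds z]
      fun w : ℝ => C * (Real.sqrt w : ℂ) * (g w) ^ 2 / ((f w) ^ 2 * w) := by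
    filter_upwards [Ioi_mem_nhds hz] with w hw using (key w hw).deriv
  refine HasDerivAt.congr_of_eventuallyEq ?_ heq
  obtain ⟨f1, -⟩ := hd f hf z hz
  obtain ⟨g1, -⟩ := hd g hg z hz
  have hz0 : (z : ℂ) ≠ 0 := by exact_mod_cast hz.ne'
  have hfz := hf0 z hz
  have hgz := hg0 z hz
  have hs := (Real.hasDerivAt_sqrt hz.ne').ofReal_comp
  have hs0 : (Real.sqrt z : ℂ) ≠ 0 := by exact_mod_cast (Real.sqrt_pos.2 hz).ne'
  have hss : (z : ℂ) = (Real.sqrt z : ℂ) ^ 2 := by exact_mod_cast (Real.sq_sqrt hz.le).symm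
  refine (((hs.const_mul C).mul (g1.pow 2)).div ((f1.pow 2).mul (hid z)) (mul_ne_zero (pow_ne_zero 2 hfz) hz0)).congr_deriv ?_
  simp only [hx, hy, Pi.mul_apply, Pi.pow_apply]
  push_cast
  generalize (Real.sqrt z : ℂ) = s at *
  rw [hss]
  field_simp
  ring


theorem toda_like_equations_converse
    (C : ℂ) (hC : C ≠ 0)
    (τ τ₁ : ℝ → ℂ)
    (hτ : ContDiffOn ℝ (⊤ : ℕ∞) τ (Set.Ioi 0)) (hτ₁ : ContDiffOn ℝ (⊤ : ℕ∞) τ₁ (Set.Ioi 0))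
    (hτ0 : ∀ z ∈ Set.Ioi (0:ℝ), τ z ≠ 0) (hτ₁0 : ∀ z ∈ Set.Ioi (0:ℝ), τ₁ z ≠ 0)
    (hToda1 : ∀ z ∈ Set.Ioi (0:ℝ),
      hirota 2 τ τ z = 2 * C * (Real.sqrt z : ℂ) * (τ₁ z) ^ 2)
    (hToda2 : ∀ z ∈ Set.Ioi (0:ℝ),
      hirota 2 τ₁ τ₁ z = 2 * C⁻¹ * (Real.sqrt z : ℂ) * (τ z) ^ 2)
    (ζ ζ₁ : ℝ → ℂ)
    (hζ : ζ = fun z : ℝ => (z : ℂ) * deriv τ z / τ z)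
    (hζ₁ : ζ₁ = fun z : ℝ => (z : ℂ) * deriv τ₁ z / τ₁ z)
    (hζ'' : ∀ z ∈ Set.Ioi (0:ℝ), deriv (deriv ζ) z ≠ 0)
    (hζ₁'' : ∀ z ∈ Set.Ioi (0:ℝ), deriv (deriv ζ₁) z ≠ 0) :
    (∀ z ∈ Set.Ioi (0:ℝ), (z : ℂ) * deriv ζ z * deriv ζ₁ z = 1) ∧
    ∃ K : ℂ,
      (∀ z ∈ Set.Ioi (0:ℝ),
        ((z : ℂ) * deriv (deriv ζ) z) ^ 2
          = 4 * (deriv ζ z) ^ 2 * (ζ z - K - (z : ℂ) * deriv ζ z) - 4 * deriv ζ z) ∧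
      (∀ z ∈ Set.Ioi (0:ℝ),
        ((z : ℂ) * deriv (deriv ζ₁) z) ^ 2
          = 4 * (deriv ζ₁ z) ^ 2 * (ζ₁ z - K - (z : ℂ) * deriv ζ₁ z) - 4 * deriv ζ₁ z) ∧
      (∀ z ∈ Set.Ioi (0:ℝ),
        ζ₁ z = ζ z + (z : ℂ) * deriv (deriv ζ) z / (2 * deriv ζ z) + 1 / 4) := by
  have P := toda_aux_pair C τ τ₁ hτ hτ₁ hτ0 hτ₁0 hToda1 ζ ζ₁ hζ hζ₁
  have Q := toda_aux_pair C⁻¹ τ₁ τ hτ₁ hτ hτ₁0 hτ0 hToda2 ζ₁ ζ hζ₁ hζ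
  have hprod : ∀ z ∈ Set.Ioi (0:ℝ), (z : ℂ) * deriv ζ z * deriv ζ₁ z = 1 := by
    intro z hz
    have hz0 : (z : ℂ) ≠ 0 := by exact_mod_cast (ne_of_gt hz)
    have h1 := hτ0 z hz
    have h2 := hτ₁0 z hz
    have hss : (Real.sqrt z : ℂ) ^ 2 = z := by exact_mod_cast (Real.sq_sqrt (le_of_lt hz))
    rw [(P z hz).1.deriv, (Q z hz).1.deriv]
    field_simp
    linear_combination hss
  have hA : ∀ z ∈ Set.Ioi (0:ℝ), HasDerivAt ζ (deriv ζ z) z ∧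
      HasDerivAt (deriv ζ) (deriv ζ z * (-1 / 2 + 2 * (ζ₁ z - ζ z)) / z) z := by
    intro z hz
    rw [(P z hz).1.deriv]
    exact P z hz
  have hB : ∀ z ∈ Set.Ioi (0:ℝ), HasDerivAt ζ₁ (deriv ζ₁ z) z ∧
      HasDerivAt (deriv ζ₁) (deriv ζ₁ z * (-1 / 2 + 2 * (ζ z - ζ₁ z)) / z) z := by
    intro z hz
    rw [(Q z hz).1.deriv]
    exact Q z hz
  refine ⟨hprod, ?_⟩
  have hid : ∀ w : ℝ, HasDerivAt (fun t : ℝ => (t : ℂ)) 1 w := fun w =>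
    (HasDerivAt.ofReal_comp (hasDerivAt_id w)).congr_deriv (by simp)
  let F : ℝ → ℂ := fun z => ζ z - z * deriv ζ z - (ζ₁ z - ζ z - 1 / 4) ^ 2 - z * deriv ζ₁ z
  have hF : ∀ z ∈ Set.Ioi (0:ℝ), HasDerivAt F 0 z := by
    intro z hz
    have hz0 : (z : ℂ) ≠ 0 := by exact_mod_cast (ne_of_gt hz)
    obtain ⟨a1, a2⟩ := hA z hz
    obtain ⟨b1, b2⟩ := hB z hz
    refine (((a1.sub ((hid z).mul a2)).sub (((b1.sub a1).sub_const (1 / 4)).pow 2)).sub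
      ((hid z).mul b2)).congr_deriv ?_
    simp only [Pi.sub_apply]
    field_simp
    ring
  have hconst : ∀ z ∈ Set.Ioi (0:ℝ), F z = F 1 := by
    intro z hz
    refine isOpen_Ioi.is_const_of_deriv_eq_zero (s := Set.Ioi (0:ℝ)) isPreconnected_Ioi
      (fun w hw => (hF w hw).differentiableAt.differentiableWithinAt)
      (fun w hw => (hF w hw).deriv) hz (Set.mem_Ioi.2 one_pos)
  refine ⟨F 1, ?_, ?_, ?_⟩
  · intro z hz
    have hz0 : (z : ℂ) ≠ 0 := by exact_mod_cast (ne_of_gt hz)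
    have hp := hprod z hz
    rw [← hconst z hz, (hA z hz).2.deriv, mul_div_cancel₀ _ hz0]
    simp only [F]
    linear_combination (-4 * deriv ζ z) * hp
  · intro z hz
    have hz0 : (z : ℂ) ≠ 0 := by exact_mod_cast (ne_of_gt hz)
    have hp := hprod z hz
    rw [← hconst z hz, (hB z hz).2.deriv, mul_div_cancel₀ _ hz0]
    simp only [F]
    linear_combination (-4 * deriv ζ₁ z) * hp
  · intro z hz
    have hz0 : (z : ℂ) ≠ 0 := by exact_mod_cast (ne_of_gt hz)
    have hne : deriv ζ z ≠ 0 := by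
      intro h
      have hp := hprod z hz
      simp [h] at hp
    rw [(hA z hz).2.deriv]
    field_simp
    ring
end

section
/- Let ζ, ζ₁ : (0,∞) → ℂ be twice continuously differentiable, set δ := z·d/dz, and assume δζ and δζ₁ are nowhere vanishing. Suppose δ²ζ = −(2ζ − 2ζ₁ − 1/2)·δζ and δ²ζ₁ = (2ζ − 2ζ₁ + 1/2)·δζ₁ on (0,∞). Then there exists a nonzero constant D ∈ ℂ such that (δζ)(δζ₁) = D·z on (0,∞), i.e. z·ζ'(z)·ζ₁'(z) = D for all z > 0. -/
theorem euler_hasDerivAt (f : ℝ → ℂ) (hf : ContDiffOn ℝ 2 f (Set.Ioi 0)) (z : ℝ)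
    (hz : z ∈ Set.Ioi (0:ℝ)) : HasDerivAt (euler f) (deriv (euler f) z) z := by
  have h : ContDiffOn ℝ 1 (deriv f) (Set.Ioi 0) :=
    hf.deriv_of_isOpen isOpen_Ioi (by norm_num)
  have hd : DifferentiableAt ℝ (deriv f) z :=
    (h.differentiableOn (by norm_num)).differentiableAt (isOpen_Ioi.mem_nhds hz)
  have hc : DifferentiableAt ℝ (fun x : ℝ => (x : ℂ)) z :=
    Complex.ofRealCLM.differentiableAt
  exact (hc.mul hd).hasDerivAt

theorem first_integral_okamoto_converse
    (ζ ζ₁ : ℝ → ℂ)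
    (hζ : ContDiffOn ℝ 2 ζ (Set.Ioi 0)) (hζ₁ : ContDiffOn ℝ 2 ζ₁ (Set.Ioi 0))
    (hδζ : ∀ z ∈ Set.Ioi (0:ℝ), euler ζ z ≠ 0)
    (hδζ₁ : ∀ z ∈ Set.Ioi (0:ℝ), euler ζ₁ z ≠ 0)
    (h1 : ∀ z ∈ Set.Ioi (0:ℝ),
      euler (euler ζ) z = -(2 * ζ z - 2 * ζ₁ z - 1 / 2) * euler ζ z)
    (h2 : ∀ z ∈ Set.Ioi (0:ℝ),
      euler (euler ζ₁) z = (2 * ζ z - 2 * ζ₁ z + 1 / 2) * euler ζ₁ z) :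
    ∃ D : ℂ, D ≠ 0 ∧
      (∀ z ∈ Set.Ioi (0:ℝ), euler ζ z * euler ζ₁ z = D * (z : ℂ)) ∧
      (∀ z ∈ Set.Ioi (0:ℝ), (z : ℂ) * deriv ζ z * deriv ζ₁ z = D) := by
  have key : ∀ z ∈ Set.Ioi (0:ℝ),
      HasDerivAt (fun x : ℝ => euler ζ x * euler ζ₁ x * (x : ℂ)⁻¹) 0 z := by
    intro z hz
    have hz0 : (z : ℂ) ≠ 0 := by exact_mod_cast (ne_of_gt hz)
    have hc : HasDerivAt (fun x : ℝ => (x : ℂ)) 1 z := Complex.ofRealCLM.hasDerivAt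
    have hd := ((euler_hasDerivAt ζ hζ z hz).mul (euler_hasDerivAt ζ₁ hζ₁ z hz)).mul
      (hc.fun_inv hz0)
    refine hd.congr_deriv ?_
    have e1 : (z : ℂ) * deriv (euler ζ) z = _ := h1 z hz
    have e2 : (z : ℂ) * deriv (euler ζ₁) z = _ := h2 z hz
    simp only [Pi.mul_apply]
    field_simp
    linear_combination euler ζ₁ z * e1 + euler ζ z * e2
  have hconst : ∀ z ∈ Set.Ioi (0:ℝ), euler ζ z * euler ζ₁ z * (z : ℂ)⁻¹ =
      euler ζ 1 * euler ζ₁ 1 * ((1 : ℝ) : ℂ)⁻¹ := by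
    intro z hz
    exact isOpen_Ioi.is_const_of_deriv_eq_zero (isPreconnected_Ioi)
      (fun x hx => (key x hx).differentiableAt.differentiableWithinAt)
      (fun x hx => (key x hx).deriv) hz (Set.mem_Ioi.2 one_pos)
  have h1m : (1 : ℝ) ∈ Set.Ioi (0:ℝ) := Set.mem_Ioi.2 one_pos
  refine ⟨euler ζ 1 * euler ζ₁ 1 * ((1 : ℝ) : ℂ)⁻¹, ?_, ?_, ?_⟩
  · simpa using ⟨hδζ 1 h1m, hδζ₁ 1 h1m⟩
  · intro z hz
    have hz0 : (z : ℂ) ≠ 0 := by exact_mod_cast (ne_of_gt hz)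
    rw [← hconst z hz]
    field_simp
  · intro z hz
    have hz0 : (z : ℂ) ≠ 0 := by exact_mod_cast (ne_of_gt hz)
    rw [← hconst z hz]
    simp only [euler]
    field_simp
end

section
/- Let ζ : (0,∞) → ℂ be smooth with ζ' and ζ'' nowhere vanishing, set δ := z·d/dz, and suppose ζ satisfies −(δ³ζ)(δζ) + (δ²ζ)² = 2(δζ)³ − 2z·(δζ) on (0,∞). Then there exists a constant K ∈ ℂ such that z²(ζ'')² − 4(ζ')²(ζ − zζ') + 4ζ' = 4K·(ζ')² on (0,∞); equivalently, ζ − K satisfies the ζ-form equation of Painlevé III(D8). -/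
theorem first_integral_toda_converse
    (ζ : ℝ → ℂ) (hζ : ContDiffOn ℝ (⊤ : ℕ∞) ζ (Set.Ioi 0))
    (hζ' : ∀ z ∈ Set.Ioi (0:ℝ), deriv ζ z ≠ 0)
    (hζ'' : ∀ z ∈ Set.Ioi (0:ℝ), deriv (deriv ζ) z ≠ 0)
    (heq : ∀ z ∈ Set.Ioi (0:ℝ),
      -(euler^[3] ζ z) * euler ζ z + (euler^[2] ζ z) ^ 2
        = 2 * (euler ζ z) ^ 3 - 2 * (z : ℂ) * euler ζ z) :
    ∃ K : ℂ, ∀ z ∈ Set.Ioi (0:ℝ),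
      (z : ℂ) ^ 2 * (deriv (deriv ζ) z) ^ 2
          - 4 * (deriv ζ z) ^ 2 * (ζ z - (z : ℂ) * deriv ζ z) + 4 * deriv ζ z
        = 4 * K * (deriv ζ z) ^ 2 := by
  have ho : IsOpen (Set.Ioi (0:ℝ)) := isOpen_Ioi
  have h1 : ContDiffOn ℝ (⊤ : ℕ∞) (deriv ζ) (Set.Ioi 0) :=
    hζ.deriv_of_isOpen ho (by simp)
  have h2 : ContDiffOn ℝ (⊤ : ℕ∞) (deriv (deriv ζ)) (Set.Ioi 0) :=
    h1.deriv_of_isOpen ho (by simp)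
  have key : ∀ f : ℝ → ℂ, ContDiffOn ℝ (⊤ : ℕ∞) f (Set.Ioi 0) →
      ∀ z ∈ Set.Ioi (0:ℝ), HasDerivAt f (deriv f z) z := fun f hf z hz =>
    ((hf.differentiableOn (by simp)).differentiableAt (ho.mem_nhds hz)).hasDerivAt
  have hid : ∀ z : ℝ, HasDerivAt (fun x : ℝ => (x : ℂ)) 1 z := fun z =>
    Complex.ofRealCLM.hasDerivAt
  have e2 : ∀ z ∈ Set.Ioi (0:ℝ), HasDerivAt (euler ζ)
      (deriv ζ z + z * deriv (deriv ζ) z) z := fun z hz => by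
    have := (hid z).mul (key _ h1 z hz)
    rw [one_mul] at this
    exact this
  have e2v : ∀ z ∈ Set.Ioi (0:ℝ), euler (euler ζ) z
      = z * (deriv ζ z + z * deriv (deriv ζ) z) := fun z hz => by
    show (z : ℂ) * deriv (euler ζ) z = _
    rw [(e2 z hz).deriv]
  have e3v : ∀ z ∈ Set.Ioi (0:ℝ), euler (euler (euler ζ)) z
      = z * ((deriv ζ z + z * deriv (deriv ζ) z) + z * (deriv (deriv ζ) z
        + (deriv (deriv ζ) z + z * deriv (deriv (deriv ζ)) z))) := fun z hz => by
    show (z : ℂ) * deriv (euler (euler ζ)) z = _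
    have hd := (hid z).mul ((key _ h1 z hz).add ((hid z).mul (key _ h2 z hz)))
    have hev : euler (euler ζ) =ᶠ[nhds z]
        ((fun x : ℝ => (x : ℂ)) * (deriv ζ + (fun x : ℝ => (x : ℂ)) * deriv (deriv ζ))) := by
      filter_upwards [ho.mem_nhds hz] with x hx
      exact e2v x hx
    rw [hev.deriv_eq, hd.deriv]
    simp only [Pi.add_apply, Pi.mul_apply]
    ring
  let F : ℝ → ℂ := fun z => ((z : ℂ) * deriv (deriv ζ) z / deriv ζ z) ^ 2
    - 4 * (ζ z - (z : ℂ) * deriv ζ z) + 4 / deriv ζ z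
  have hF : ∀ z ∈ Set.Ioi (0:ℝ), HasDerivAt F 0 z := by
    intro z hz
    have ha := hζ' z hz
    have hz0 : (z : ℂ) ≠ 0 := by
      have : (0:ℝ) < z := hz
      exact_mod_cast this.ne'
    have d := (((((hid z).mul (key _ h2 z hz)).div (key _ h1 z hz) ha).pow 2).sub
      (((key _ hζ z hz).sub ((hid z).mul (key _ h1 z hz))).const_mul 4)).add
      ((hasDerivAt_const z (4:ℂ)).div (key _ h1 z hz) ha)
    refine HasDerivAt.congr_deriv d ?_
    have h := heq z hz
    simp only [Function.iterate_succ, Function.iterate_zero, Function.comp, id] at h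
    rw [e3v z hz, e2v z hz] at h
    simp only [euler] at h
    simp only [Pi.mul_apply, Pi.div_apply]
    generalize deriv (deriv (deriv ζ)) z = c at *
    generalize deriv (deriv ζ) z = b at *
    generalize deriv ζ z = a at *
    have h' : (z:ℂ) * a * b + z ^ 2 * a * c - z ^ 2 * b ^ 2 + 2 * z * a ^ 3 - 2 * a = 0 := by
      have : (z:ℂ) ^ 2 *
          (z * a * b + z ^ 2 * a * c - z ^ 2 * b ^ 2 + 2 * z * a ^ 3 - 2 * a) = 0 := by
        linear_combination -h
      exact (mul_eq_zero.mp this).resolve_left (pow_ne_zero 2 hz0)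
    have : (2 * b / a ^ 3) *
        ((z:ℂ) * a * b + z ^ 2 * a * c - z ^ 2 * b ^ 2 + 2 * z * a ^ 3 - 2 * a) = 0 := by
      rw [h', mul_zero]
    refine Eq.trans ?_ this
    norm_num only [Nat.cast_ofNat, pow_one, zero_mul, zero_sub, one_mul]
    field_simp
    ring
  refine ⟨F 1 / 4, fun z hz => ?_⟩
  have hc : F z = F 1 := by
    refine ho.is_const_of_deriv_eq_zero (convex_Ioi (0:ℝ)).isPreconnected
      (fun x hx => (hF x hx).differentiableAt.differentiableWithinAt)
      (fun x hx => (hF x hx).deriv) hz (by simp)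
  rw [← hc]
  have ha := hζ' z hz
  simp only [F]
  field_simp
end

section
/- For each ε ∈ {1, −1}: the function ζ(z) = 1/16 − 2ε√z satisfies the ζ-form equation (zζ'')² = 4(ζ')²(ζ − zζ') − 4ζ' on (0,∞); the function τ(z) = z^{1/16}·e^{−4ε√z} satisfies zτ'(z) = ζ(z)τ(z) on (0,∞); and τ satisfies the τ-form of Painlevé III(D8): (1/2)D⁴(τ,τ) − (z·d/dz)(D²(τ,τ)) + (1/2)D²(τ,τ) + 2z·τ² = 0 on (0,∞). These are the τ-functions of the algebraic solutions w = ε√z of Painlevé III(D8). -/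
open Polynomial in
/-- The Euler operator on functions of the form `p(√z) τ^m`. -/
theorem euler_aux (ε : ℂ) (τ : ℝ → ℂ)
    (hd : ∀ z : ℝ, 0 < z →
      HasDerivAt τ ((1 / 16 - 2 * ε * (Real.sqrt z : ℂ)) * τ z / (z : ℂ)) z)
    (m : ℕ) (p : ℂ[X]) (F : ℝ → ℂ)
    (hF : ∀ z : ℝ, 0 < z → F z = p.eval (Real.sqrt z : ℂ) * τ z ^ m) :
    ∀ z : ℝ, 0 < z → euler F z =
      (C (1 / 2) * X * derivative p + C (m : ℂ) * (C (1 / 16) - C (2 * ε) * X) * p).eval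
        (Real.sqrt z : ℂ) * τ z ^ m := by
  intro z hz
  have hs : HasDerivAt (fun z : ℝ => (Real.sqrt z : ℂ)) ((1 / (2 * Real.sqrt z) : ℝ) : ℂ) z :=
    (Real.hasDerivAt_sqrt hz.ne').ofReal_comp
  have h1 : HasDerivAt (fun z : ℝ => p.eval (Real.sqrt z : ℂ))
      ((derivative p).eval (Real.sqrt z : ℂ) * ((1 / (2 * Real.sqrt z) : ℝ) : ℂ)) z :=
    HasDerivAt.comp (h₂ := fun x : ℂ => p.eval x) (h := fun z : ℝ => (Real.sqrt z : ℂ)) z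
      (p.hasDerivAt (Real.sqrt z : ℂ)) hs
  have h2 := h1.mul ((hd z hz).pow m)
  have h3 : F =ᶠ[nhds z] ((fun z : ℝ => p.eval (Real.sqrt z : ℂ)) * τ ^ m) := by
    filter_upwards [Ioi_mem_nhds hz] with y hy
    simpa using hF y hy
  have hsz : (Real.sqrt z : ℂ) ≠ 0 := by
    exact_mod_cast (Real.sqrt_pos.2 hz).ne'
  have hzz : (z : ℂ) = (Real.sqrt z : ℂ) ^ 2 := by
    exact_mod_cast (Real.sq_sqrt hz.le).symm
  unfold euler
  rw [h3.deriv_eq, h2.deriv]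
  simp only [eval_add, eval_mul, eval_C, eval_X, eval_sub, Pi.pow_apply]
  push_cast
  rw [hzz]
  rcases m with _ | m
  · simp
    field_simp
  · simp only [Nat.add_sub_cancel, pow_succ]
    field_simp
    try ring

open Polynomial in
theorem algebraic_tau_functions_painleveIII_D8
    (ε : ℂ) (hε : ε = 1 ∨ ε = -1)
    (ζ : ℝ → ℂ) (hζ : ζ = fun z : ℝ => 1 / 16 - 2 * ε * (Real.sqrt z : ℂ))
    (τ : ℝ → ℂ)
    (hτ : τ = fun z : ℝ =>
      ((z ^ ((1:ℝ) / 16) : ℝ) : ℂ) * Complex.exp (-4 * ε * (Real.sqrt z : ℂ))) :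
    ∀ z ∈ Set.Ioi (0:ℝ),
      ((z : ℂ) * deriv (deriv ζ) z) ^ 2
        = 4 * (deriv ζ z) ^ 2 * (ζ z - (z : ℂ) * deriv ζ z) - 4 * deriv ζ z ∧
      (z : ℂ) * deriv τ z = ζ z * τ z ∧
      (1 / 2) * hirota 4 τ τ z - euler (hirota 2 τ τ) z
        + (1 / 2) * hirota 2 τ τ z + 2 * (z : ℂ) * (τ z) ^ 2 = 0 := by
  have hε2 : ε ^ 2 = 1 := by rcases hε with rfl | rfl <;> norm_num
  have hs : ∀ z : ℝ, 0 < z →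
      HasDerivAt (fun z : ℝ => (Real.sqrt z : ℂ)) ((1 / (2 * Real.sqrt z) : ℝ) : ℂ) z :=
    fun z hz => (Real.hasDerivAt_sqrt hz.ne').ofReal_comp
  have hsz : ∀ z : ℝ, 0 < z → (Real.sqrt z : ℂ) ≠ 0 := fun z hz => by
    exact_mod_cast (Real.sqrt_pos.2 hz).ne'
  have hzz : ∀ z : ℝ, 0 < z → (z : ℂ) = (Real.sqrt z : ℂ) ^ 2 := fun z hz => by
    exact_mod_cast (Real.sq_sqrt hz.le).symm
  have hd : ∀ z : ℝ, 0 < z →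
      HasDerivAt τ ((1 / 16 - 2 * ε * (Real.sqrt z : ℂ)) * τ z / (z : ℂ)) z := by
    intro z hz
    have h1 : HasDerivAt (fun z : ℝ => ((z ^ ((1:ℝ) / 16) : ℝ) : ℂ))
        (((1 / 16 : ℝ) * z ^ ((1:ℝ) / 16 - 1) : ℝ) : ℂ) z :=
      (Real.hasDerivAt_rpow_const (Or.inl hz.ne')).ofReal_comp
    have h2 := ((hs z hz).const_mul (-4 * ε)).cexp
    have h3 := h1.mul h2
    rw [hτ]
    refine h3.congr_deriv ?_
    rw [Real.rpow_sub_one hz.ne']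
    have := hsz z hz
    push_cast
    rw [hzz z hz]
    field_simp
    ring
  have hdζ : ∀ z : ℝ, 0 < z → deriv ζ z = -ε * (Real.sqrt z : ℂ)⁻¹ := by
    intro z hz
    rw [hζ]
    rw [(((hs z hz).const_mul (2 * ε)).const_sub (1 / 16)).deriv]
    have := hsz z hz
    push_cast
    field_simp
  have e0 : ∀ z : ℝ, 0 < z → τ z = (1 : ℂ[X]).eval (Real.sqrt z : ℂ) * τ z ^ 1 := by
    intro z _; simp
  have e1 := euler_aux ε τ hd 1 _ _ e0
  have e2 := euler_aux ε τ hd 1 _ _ e1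
  have e3 := euler_aux ε τ hd 1 _ _ e2
  have e4 := euler_aux ε τ hd 1 _ _ e3
  have k2 : ∀ z : ℝ, 0 < z → hirota 2 τ τ z =
      (C (-2 * ε) * X : ℂ[X]).eval (Real.sqrt z : ℂ) * τ z ^ 2 := by
    intro z hz
    simp only [hirota, Finset.sum_range_succ, Finset.sum_range_zero, Function.iterate_succ,
      Function.iterate_zero, Function.comp, id]
    norm_num [Nat.choose, Function.iterate_succ, e1 z hz, e2 z hz]
    ring
  have k3 := euler_aux ε τ hd 2 _ _ k2
  intro z hz
  have hz : 0 < z := hz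
  have hne := hsz z hz
  refine ⟨?_, ?_, ?_⟩
  · have h : deriv ζ =ᶠ[nhds z] fun z => -ε * (Real.sqrt z : ℂ)⁻¹ := by
      filter_upwards [Ioi_mem_nhds hz] with y hy
      exact hdζ y hy
    rw [h.deriv_eq, (((hs z hz).fun_inv hne).const_mul (-ε)).deriv, hdζ z hz, hζ, hzz z hz]
    push_cast
    field_simp
    rcases hε with rfl | rfl <;> ring
  · rw [(hd z hz).deriv, hζ, hzz z hz]
    field_simp
  · rw [k3 z hz, k2 z hz, hzz z hz]
    simp only [hirota, Finset.sum_range_succ, Finset.sum_range_zero, Function.iterate_succ,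
      Function.iterate_zero, Function.comp, id]
    norm_num [Nat.choose, Function.iterate_succ, e1 z hz, e2 z hz, e3 z hz, e4 z hz]
    rcases hε with rfl | rfl <;> ring
end

section
/- Let v : (0,∞) → ℂ be twice continuously differentiable, and define w : (0,∞) → ℂ by w(z) = √z · exp(2i·v(r(z))), where r(z) = (4096·z)^{1/4}. Then w satisfies the Painlevé III(D8) equation w'' = (w')²/w − w'/z + 2w²/z² − 2/z on (0,∞) if and only if v satisfies the radial sine-Gordon equation v''(r) + v'(r)/r = (1/2)·sin(2v(r)) on (0,∞). -/
/-- The pointwise algebraic equivalence. -/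
lemma p3_alg (z ρ s E v1 v2 S : ℂ) (hρ : ρ ≠ 0) (hE : E ≠ 0)
    (hz : z = ρ ^ 4 / 4096) (hs : s = ρ ^ 2 / 64)
    (hS : S = (E⁻¹ - E) * Complex.I / 2)
    (g g' w w1 w2 : ℂ) (hw : w = s * E)
    (hg : g = 1 / (2 * z) + Complex.I / 2 * (v1 * ρ / z))
    (hg' : g' = -1 / (2 * z ^ 2) + Complex.I / 2 *
      (v2 * (ρ / (4 * z)) * ρ / z + v1 * (ρ / (4 * z)) / z - v1 * ρ / z ^ 2))
    (hw1 : w1 = w * g) (hw2 : w2 = w1 * g + w * g') :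
    w2 = w1 ^ 2 / w - w1 / z + 2 * w ^ 2 / z ^ 2 - 2 / z ↔
      v2 + v1 / ρ = 1 / 2 * S := by
  have hz0 : z ≠ 0 := by rw [hz]; exact div_ne_zero (pow_ne_zero _ hρ) (by norm_num)
  have hs0 : s ≠ 0 := by rw [hs]; exact div_ne_zero (pow_ne_zero _ hρ) (by norm_num)
  have hw0 : w ≠ 0 := by rw [hw]; exact mul_ne_zero hs0 hE
  have key : w2 - (w1 ^ 2 / w - w1 / z + 2 * w ^ 2 / z ^ 2 - 2 / z)
      = (w * Complex.I * ρ ^ 2 / (8 * z ^ 2)) * (v2 + v1 / ρ - 1 / 2 * S) := by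
    have h1 : w1 ^ 2 / w = w1 * g := by rw [hw1]; field_simp
    have h2 : g' + g / z = Complex.I * ρ ^ 2 / (8 * z ^ 2) * (v2 + v1 / ρ) := by
      rw [hg, hg']; field_simp; ring
    have h3 : 2 * w ^ 2 / z ^ 2 - 2 / z
        = (w * Complex.I * ρ ^ 2 / (8 * z ^ 2)) * (1 / 2 * S) := by
      have hI := Complex.I_sq
      have e : (w * Complex.I * ρ ^ 2 / (8 * z ^ 2)) * (1 / 2 * S)
          = w * ρ ^ 2 / (32 * z ^ 2) * (E⁻¹ - E) * Complex.I ^ 2 := by rw [hS]; ring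
      rw [e, hI, hw, hs, hz]; field_simp; ring
    rw [h1, hw2]
    have h4 : w1 / z = w * (g / z) := by rw [hw1]; ring
    rw [h4]
    linear_combination w * h2 - h3
  have hc : w * Complex.I * ρ ^ 2 / (8 * z ^ 2) ≠ 0 := by
    exact div_ne_zero (mul_ne_zero (mul_ne_zero hw0 Complex.I_ne_zero) (pow_ne_zero _ hρ))
      (mul_ne_zero (by norm_num) (pow_ne_zero _ hz0))
  rw [← sub_eq_zero, key, mul_eq_zero, or_iff_right hc, sub_eq_zero]

theorem painleveIII_D8_iff_radial_sine_gordon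
    (v : ℝ → ℂ) (hv : ContDiffOn ℝ 2 v (Set.Ioi 0))
    (r : ℝ → ℝ) (hr : r = fun z : ℝ => (4096 * z) ^ ((1:ℝ) / 4))
    (w : ℝ → ℂ)
    (hw : w = fun z : ℝ => (Real.sqrt z : ℂ) * Complex.exp (2 * Complex.I * v (r z))) :
    (∀ z ∈ Set.Ioi (0:ℝ),
      deriv (deriv w) z
        = (deriv w z) ^ 2 / w z - deriv w z / (z : ℂ)
          + 2 * (w z) ^ 2 / (z : ℂ) ^ 2 - 2 / (z : ℂ)) ↔
    (∀ ρ ∈ Set.Ioi (0:ℝ),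
      deriv (deriv v) ρ + deriv v ρ / (ρ : ℂ)
        = (1 / 2) * Complex.sin (2 * v ρ)) := by
  have rpos : ∀ z : ℝ, 0 < z → 0 < r z := by
    intro z hz; rw [hr]; positivity
  have r4 : ∀ z : ℝ, 0 < z → z = r z ^ 4 / 4096 := by
    intro z hz
    have : r z ^ 4 = 4096 * z := by
      rw [hr]; simp only
      rw [← Real.rpow_natCast, ← Real.rpow_mul (by positivity)]
      norm_num
    rw [this]; ring
  have rs : ∀ z : ℝ, 0 < z → Real.sqrt z = r z ^ 2 / 64 := by
    intro z hz
    rw [Real.sqrt_eq_iff_mul_self_eq hz.le (by positivity)]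
    have := r4 z hz
    linarith
  have rsurj : ∀ ρ : ℝ, 0 < ρ → ∃ z, 0 < z ∧ r z = ρ := by
    intro ρ hρ
    refine ⟨ρ ^ 4 / 4096, by positivity, ?_⟩
    have h1 := r4 (ρ ^ 4 / 4096) (by positivity)
    have h2 := rpos (ρ ^ 4 / 4096) (by positivity)
    exact (pow_left_inj₀ h2.le hρ.le (by norm_num : 4 ≠ 0)).1 (by linarith)
  have rder : ∀ z : ℝ, 0 < z → HasDerivAt r (r z / (4 * z)) z := by
    intro z hz
    have h1 : HasDerivAt (fun z : ℝ => 4096 * z) 4096 z := by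
      simpa using (hasDerivAt_id z).const_mul 4096
    have h2 := h1.rpow_const (p := (1:ℝ)/4) (Or.inl (by positivity))
    rw [hr]
    convert h2 using 1
    simp only
    rw [Real.rpow_sub_one (by positivity)]
    field_simp
  have vder : ∀ ρ : ℝ, 0 < ρ → HasDerivAt v (deriv v ρ) ρ := by
    intro ρ hρ
    exact ((hv.contDiffAt (Ioi_mem_nhds hρ)).differentiableAt (by norm_num)).hasDerivAt
  have vder2 : ∀ ρ : ℝ, 0 < ρ → HasDerivAt (deriv v) (deriv (deriv v) ρ) ρ := by
    intro ρ hρ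
    have h := (contDiffOn_succ_iff_deriv_of_isOpen (n := 1) isOpen_Ioi).1 hv
    exact ((h.2.2.contDiffAt (Ioi_mem_nhds hρ)).differentiableAt (by norm_num)).hasDerivAt
  have vr : ∀ z : ℝ, 0 < z →
      HasDerivAt (fun z => v (r z)) (deriv v (r z) * ((r z : ℂ) / (4 * z))) z := by
    intro z hz
    have := (vder _ (rpos z hz)).scomp z (rder z hz)
    refine HasDerivAt.congr_deriv this ?_
    rw [Complex.real_smul]
    push_cast
    ring
  have vr2 : ∀ z : ℝ, 0 < z →
      HasDerivAt (fun z => deriv v (r z))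
        (deriv (deriv v) (r z) * ((r z : ℂ) / (4 * z))) z := by
    intro z hz
    have := (vder2 _ (rpos z hz)).scomp z (rder z hz)
    refine HasDerivAt.congr_deriv this ?_
    rw [Complex.real_smul]
    push_cast
    ring
  have w1 : ∀ z : ℝ, 0 < z → HasDerivAt w
      (w z * (1 / (2 * (z:ℂ)) + Complex.I / 2 * (deriv v (r z) * (r z : ℂ) / (z:ℂ)))) z := by
    intro z hz
    have hz' : (z:ℂ) ≠ 0 := by exact_mod_cast hz.ne'
    have h1 := (Real.hasDerivAt_sqrt hz.ne').ofReal_comp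
    have h2 := ((vr z hz).const_mul (2 * Complex.I)).cexp
    have h3 := h1.mul h2
    rw [hw]
    refine HasDerivAt.congr_deriv h3 ?_
    simp only
    have hq : ((Real.sqrt z : ℝ) : ℂ) ^ 2 = z := by exact_mod_cast Real.sq_sqrt hz.le
    have hq0 : ((Real.sqrt z : ℝ) : ℂ) ≠ 0 := by
      exact_mod_cast (Real.sqrt_pos.2 hz).ne'
    push_cast
    rw [← hq]
    field_simp
    ring
  have w2 : ∀ z : ℝ, 0 < z → deriv (deriv w) z =
      (deriv w z) * (1 / (2 * (z:ℂ)) + Complex.I / 2 * (deriv v (r z) * (r z : ℂ) / (z:ℂ)))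
      + w z * (-1 / (2 * (z:ℂ) ^ 2) + Complex.I / 2 *
      (deriv (deriv v) (r z) * ((r z : ℂ) / (4 * z)) * (r z : ℂ) / z
        + deriv v (r z) * ((r z : ℂ) / (4 * z)) / z - deriv v (r z) * (r z : ℂ) / z ^ 2)) := by
    intro z hz
    have hz' : (z:ℂ) ≠ 0 := by exact_mod_cast hz.ne'
    have heq : deriv w =ᶠ[nhds z] fun z => w z * (1 / (2 * (z:ℂ)) +
        Complex.I / 2 * (deriv v (r z) * (r z : ℂ) / (z:ℂ))) := by
      filter_upwards [Ioi_mem_nhds hz] with y hy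
      exact (w1 y hy).deriv
    rw [heq.deriv_eq]
    have hid : HasDerivAt (fun z : ℝ => (z : ℂ)) 1 z := by
      simpa using (hasDerivAt_id z).ofReal_comp
    have hrc := (rder z hz).ofReal_comp
    have ha : HasDerivAt (fun z : ℝ => 1 / (2 * (z:ℂ))) (-1 / (2 * (z:ℂ) ^ 2)) z := by
      have := (hasDerivAt_const z (1:ℂ)).fun_div (hid.const_mul 2) (by simpa using hz')
      refine HasDerivAt.congr_deriv this ?_
      field_simp
      ring
    have hb := ((((vr2 z hz).fun_mul hrc).fun_div hid hz').const_mul (Complex.I / 2))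
    have hc := (w1 z hz).fun_mul (ha.fun_add hb)
    rw [hc.deriv, (w1 z hz).deriv]
    congr 2
    congr 2
    push_cast
    field_simp
  have main : ∀ z : ℝ, 0 < z → ((deriv (deriv w) z
        = (deriv w z) ^ 2 / w z - deriv w z / (z : ℂ)
          + 2 * (w z) ^ 2 / (z : ℂ) ^ 2 - 2 / (z : ℂ)) ↔
      (deriv (deriv v) (r z) + deriv v (r z) / (r z : ℂ)
        = (1 / 2) * Complex.sin (2 * v (r z)))) := by
    intro z hz
    refine p3_alg (z : ℂ) (r z : ℂ) (Real.sqrt z : ℂ) (Complex.exp (2 * Complex.I * v (r z)))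
      _ _ _ ?_ (Complex.exp_ne_zero _) ?_ ?_ ?_ _ _ _ _ _ ?_ rfl rfl (w1 z hz).deriv (w2 z hz)
    · exact_mod_cast (rpos z hz).ne'
    · exact_mod_cast r4 z hz
    · exact_mod_cast rs z hz
    · rw [← Complex.exp_neg, Complex.sin]
      ring_nf
    · rw [hw]
  constructor
  · intro h ρ hρ
    obtain ⟨z, hz, rfl⟩ := rsurj ρ hρ
    exact (main z hz).1 (h z hz)
  · intro h z hz
    exact (main z hz).2 (h _ (rpos z hz))
end
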